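/- arXiv:1612.08918 — 3 statements merged into one kernel-verified Lean document; each statement's English description precedes it below -/
import Mathlib

section
/- Among all three-dimensional lattice polytopes P with exactly two interior lattice points, one of which is the origin, the normalized volume Vol(P*) of the dual polytope P* = {y ∈ ℝ³ : ⟨y, x⟩ ≤ 1 for all x ∈ P} is at most 243/2, and this maximum is attained by the simplex P = conv{(−1,−1,−1),(0,−1,−1),(−1,0,−1),(7,7,8)}. -/
open Set MeasureTheory

noncomputable section

/-- The canonical embedding of lattice points `ℤ^d` into `ℝ^d`. -/
def castPt {d : ℕ} (v : Fin d → ℤ) : Fin d → ℝ := fun i => (v i : ℝ)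

/-- A lattice polytope: the convex hull of a nonempty finite set of lattice points. -/
def IsLatticePolytope {d : ℕ} (P : Set (Fin d → ℝ)) : Prop :=
  ∃ V : Finset (Fin d → ℤ), V.Nonempty ∧
    P = convexHull ℝ (castPt '' (V : Set (Fin d → ℤ)))

/-- The interior lattice points of a full-dimensional polytope `P`. -/
def intLatPts {d : ℕ} (P : Set (Fin d → ℝ)) : Set (Fin d → ℤ) :=
  {x | castPt x ∈ interior P}

/-- Unimodular equivalence: an affine lattice automorphism in `GL_d(ℤ) ⋉ ℤ^d` maps `P` onto `Q`. -/
def UnimodEquiv {d : ℕ} (P Q : Set (Fin d → ℝ)) : Prop :=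
  ∃ (A : Matrix (Fin d) (Fin d) ℤ) (b : Fin d → ℤ), IsUnit A.det ∧
    (fun x : Fin d → ℝ => (A.map (Int.cast : ℤ → ℝ)).mulVec x + castPt b) '' P = Q

/-- A three-dimensional lattice polytope with exactly `k` interior lattice points. -/
def IsKPoint3Polytope (k : ℕ) (P : Set (Fin 3 → ℝ)) : Prop :=
  IsLatticePolytope P ∧ affineSpan ℝ P = ⊤ ∧ (intLatPts P).ncard = k

/-- The polytopes satisfying `Q` form exactly `n` unimodular equivalence classes: there are
`n` representatives and every polytope satisfying `Q` is equivalent to exactly one of them. -/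
def HasNClassesUpToEquiv (Q : Set (Fin 3 → ℝ) → Prop) (n : ℕ) : Prop :=
  ∃ S : Finset (Set (Fin 3 → ℝ)), S.card = n ∧ (∀ P ∈ S, Q P) ∧
    ∀ P, Q P → ∃! R, R ∈ S ∧ UnimodEquiv P R

/-- The dual polytope `P* = {y : ⟨y,x⟩ ≤ 1 for all x ∈ P}`. -/
def dualPolytope (P : Set (Fin 3 → ℝ)) : Set (Fin 3 → ℝ) :=
  {y | ∀ x ∈ P, ∑ i, y i * x i ≤ 1}

/-- The simplex `conv{(−1,−1,−1),(0,−1,−1),(−1,0,−1),(7,7,8)}`. -/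
def Pmax : Set (Fin 3 → ℝ) :=
  convexHull ℝ {![-1,-1,-1], ![0,-1,-1], ![-1,0,-1], ![7,7,8]}

/-! ### Volumes of a few standard bodies -/

theorem vol_slices (K : Set (Fin 3 → ℝ)) (hK : MeasurableSet K) (g : ℝ → ℝ)
    (hg : Continuous g) (hg0 : ∀ x ∈ Set.Icc (0:ℝ) 1, 0 ≤ g x)
    (hs : ∀ x ∈ Set.Icc (0:ℝ) 1, volume {p : ℝ × ℝ | ![x, p.1, p.2] ∈ K} = ENNReal.ofReal (g x))
    (hs' : ∀ x, x ∉ Set.Icc (0:ℝ) 1 → ∀ y z, ![x, y, z] ∉ K) :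
    volume K = ENNReal.ofReal (∫ x in (0:ℝ)..1, g x) := by
  have e1 := (volume_preserving_piFinSuccAbove (fun _ : Fin 3 => ℝ) 0).symm
  have e2 := ((MeasurePreserving.id (volume : Measure ℝ)).prod
    (volume_preserving_finTwoArrow ℝ).symm)
  have e := e1.comp e2
  have hm : volume K = volume ((fun p : ℝ × ℝ × ℝ => (![p.1, p.2.1, p.2.2] : Fin 3 → ℝ)) ⁻¹' K) := by
    rw [← e.measure_preimage hK.nullMeasurableSet]
    congr 1
    ext p
    simp only [Set.mem_preimage]
    have : ∀ a b : Fin 3 → ℝ, a = b → (a ∈ K ↔ b ∈ K) := by rintro a b rfl; rfl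
    apply this
    funext i
    fin_cases i <;> rfl
  have hmeas : Measurable (fun p : ℝ × ℝ × ℝ => (![p.1, p.2.1, p.2.2] : Fin 3 → ℝ)) := by
    rw [measurable_pi_iff]
    intro i
    fin_cases i <;> simp <;> fun_prop
  rw [hm, Measure.volume_eq_prod, Measure.prod_apply (hmeas hK)]
  have : ∀ x : ℝ, volume (Prod.mk x ⁻¹' ((fun p : ℝ × ℝ × ℝ => (![p.1, p.2.1, p.2.2] : Fin 3 → ℝ)) ⁻¹' K))
      = (Set.Icc (0:ℝ) 1).indicator (fun x => ENNReal.ofReal (g x)) x := by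
    intro x
    by_cases hx : x ∈ Set.Icc (0:ℝ) 1
    · rw [Set.indicator_of_mem hx, ← hs x hx]
      rfl
    · rw [Set.indicator_of_notMem hx]
      have : (Prod.mk x ⁻¹' ((fun p : ℝ × ℝ × ℝ => (![p.1, p.2.1, p.2.2] : Fin 3 → ℝ)) ⁻¹' K)) = ∅ := by
        ext p
        simp only [Set.mem_preimage, Set.mem_empty_iff_false, iff_false]
        exact hs' x hx _ _
      rw [this, measure_empty]
  simp_rw [this]
  rw [lintegral_indicator measurableSet_Icc, ← ofReal_integral_eq_lintegral_ofReal,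
    intervalIntegral.integral_of_le zero_le_one, integral_Icc_eq_integral_Ioc]
  · exact (hg.integrableOn_Icc)
  · exact (ae_restrict_iff' measurableSet_Icc).2 (Filter.Eventually.of_forall hg0)

theorem area_tri (s : ℝ) (hs : 0 ≤ s) :
    volume {p : ℝ × ℝ | 0 ≤ p.1 ∧ 0 ≤ p.2 ∧ p.1 + p.2 ≤ s} = ENNReal.ofReal (s ^ 2 / 2) := by
  have hm : MeasurableSet {p : ℝ × ℝ | 0 ≤ p.1 ∧ 0 ≤ p.2 ∧ p.1 + p.2 ≤ s} := by
    apply IsClosed.measurableSet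
    simp only [Set.ofPred_and]
    refine IsClosed.inter ?_ (IsClosed.inter ?_ ?_) <;>
      exact isClosed_le (by fun_prop) (by fun_prop)
  rw [Measure.volume_eq_prod, Measure.prod_apply hm]
  have : ∀ x : ℝ, volume (Prod.mk x ⁻¹' {p : ℝ × ℝ | 0 ≤ p.1 ∧ 0 ≤ p.2 ∧ p.1 + p.2 ≤ s})
      = (Set.Icc (0:ℝ) s).indicator (fun x => ENNReal.ofReal (s - x)) x := by
    intro x
    by_cases hx : x ∈ Set.Icc (0:ℝ) s
    · rw [Set.indicator_of_mem hx]
      have : Prod.mk x ⁻¹' {p : ℝ × ℝ | 0 ≤ p.1 ∧ 0 ≤ p.2 ∧ p.1 + p.2 ≤ s} = Set.Icc 0 (s - x) := by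
        ext y
        simp only [Set.mem_preimage, Set.mem_ofPred_eq, Set.mem_Icc]
        constructor
        · rintro ⟨_, h1, h2⟩; exact ⟨h1, by linarith⟩
        · rintro ⟨h1, h2⟩; exact ⟨hx.1, h1, by linarith⟩
      rw [this, Real.volume_Icc, sub_zero]
    · rw [Set.indicator_of_notMem hx]
      have : Prod.mk x ⁻¹' {p : ℝ × ℝ | 0 ≤ p.1 ∧ 0 ≤ p.2 ∧ p.1 + p.2 ≤ s} = ∅ := by
        ext y
        simp only [Set.mem_preimage, Set.mem_ofPred_eq, Set.mem_empty_iff_false, iff_false]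
        rintro ⟨h0, h1, h2⟩
        exact hx ⟨h0, by linarith⟩
      rw [this, measure_empty]
  simp_rw [this]
  rw [lintegral_indicator measurableSet_Icc, ← ofReal_integral_eq_lintegral_ofReal,
    integral_Icc_eq_integral_Ioc, ← intervalIntegral.integral_of_le hs]
  · congr 1
    rw [intervalIntegral.integral_sub (by simp) (by simp)]
    simp
    ring
  · exact (by fun_prop : Continuous fun x : ℝ => s - x).integrableOn_Icc
  · exact (ae_restrict_iff' measurableSet_Icc).2
      (Filter.Eventually.of_forall fun x hx => by simpa using hx.2)

/-- the standard simplex -/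
def bodySimplex : Set (Fin 3 → ℝ) := {t | 0 ≤ t 0 ∧ 0 ≤ t 1 ∧ 0 ≤ t 2 ∧ t 0 + t 1 + t 2 ≤ 1}
/-- a prism -/
def bodyPrism : Set (Fin 3 → ℝ) :=
  {t | 0 ≤ t 0 ∧ t 0 ≤ 1 ∧ 0 ≤ t 1 ∧ 0 ≤ t 2 ∧ t 1 + t 2 ≤ 1}
/-- a square pyramid -/
def bodyPyramid : Set (Fin 3 → ℝ) :=
  {t | 0 ≤ t 0 ∧ 0 ≤ t 1 ∧ 0 ≤ t 2 ∧ t 0 + t 1 ≤ 1 ∧ t 0 + t 2 ≤ 1}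

theorem vol_simplex : volume bodySimplex = ENNReal.ofReal (1 / 6) := by
  rw [vol_slices bodySimplex ?_ (fun x => (1 - x) ^ 2 / 2) (by fun_prop)]
  · congr 1
    rw [intervalIntegral.integral_div]
    have := intervalIntegral.integral_comp_sub_left (fun x : ℝ => x ^ 2) (a := 0) (b := 1) 1
    rw [this]; simp; norm_num
  · intro x hx; positivity
  · intro x hx
    rw [← area_tri (1 - x) (by linarith [hx.2])]
    congr 1
    ext p
    simp only [bodySimplex, Set.mem_ofPred_eq, Matrix.cons_val]
    constructor
    · rintro ⟨_, h1, h2, h3⟩; exact ⟨h1, h2, by linarith⟩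
    · rintro ⟨h1, h2, h3⟩; exact ⟨hx.1, h1, h2, by linarith⟩
  · intro x hx y z h
    simp only [bodySimplex, Set.mem_ofPred_eq, Matrix.cons_val] at h
    exact hx ⟨h.1, by linarith [h.2.1, h.2.2.1, h.2.2.2]⟩
  · apply IsClosed.measurableSet
    unfold bodySimplex
    simp only [Set.ofPred_and]
    refine IsClosed.inter ?_ (IsClosed.inter ?_ (IsClosed.inter ?_ ?_)) <;>
      exact isClosed_le (by fun_prop) (by fun_prop)

theorem vol_prism : volume bodyPrism = ENNReal.ofReal (1 / 2) := by
  rw [vol_slices bodyPrism ?_ (fun x => 1 ^ 2 / 2) (by fun_prop)]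
  · congr 1
    simp
  · intro x hx; positivity
  · intro x hx
    rw [← area_tri 1 zero_le_one]
    congr 1
    ext p
    simp only [bodyPrism, Set.mem_ofPred_eq, Matrix.cons_val]
    constructor
    · rintro ⟨_, _, h⟩; exact h
    · intro h; exact ⟨hx.1, hx.2, h⟩
  · intro x hx y z h
    simp only [bodyPrism, Set.mem_ofPred_eq, Matrix.cons_val] at h
    exact hx ⟨h.1, h.2.1⟩
  · apply IsClosed.measurableSet
    unfold bodyPrism
    simp only [Set.ofPred_and]
    refine IsClosed.inter ?_ (IsClosed.inter ?_ (IsClosed.inter ?_ (IsClosed.inter ?_ ?_))) <;>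
      exact isClosed_le (by fun_prop) (by fun_prop)

theorem vol_pyramid : volume bodyPyramid = ENNReal.ofReal (1 / 3) := by
  rw [vol_slices bodyPyramid ?_ (fun x => (1 - x) ^ 2) (by fun_prop)]
  · congr 1
    have := intervalIntegral.integral_comp_sub_left (fun x : ℝ => x ^ 2) (a := 0) (b := 1) 1
    rw [this]; simp; norm_num
  · intro x hx; positivity
  · intro x hx
    have : {p : ℝ × ℝ | ![x, p.1, p.2] ∈ bodyPyramid}
        = Set.Icc 0 (1 - x) ×ˢ Set.Icc 0 (1 - x) := by
      ext p
      simp only [bodyPyramid, Set.mem_ofPred_eq, Matrix.cons_val, Set.mem_prod, Set.mem_Icc]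
      constructor
      · rintro ⟨_, h1, h2, h3, h4⟩; exact ⟨⟨h1, by linarith⟩, ⟨h2, by linarith⟩⟩
      · rintro ⟨⟨h1, h2⟩, ⟨h3, h4⟩⟩; exact ⟨hx.1, h1, h3, by linarith, by linarith⟩
    rw [this, Measure.volume_eq_prod, Measure.prod_prod, Real.volume_Icc, sub_zero,
      ← ENNReal.ofReal_mul (by linarith [hx.2]), sq]
  · intro x hx y z h
    simp only [bodyPyramid, Set.mem_ofPred_eq, Matrix.cons_val] at h
    exact hx ⟨h.1, by linarith [h.2.1, h.2.2.2.1]⟩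
  · apply IsClosed.measurableSet
    unfold bodyPyramid
    simp only [Set.ofPred_and]
    refine IsClosed.inter ?_ (IsClosed.inter ?_ (IsClosed.inter ?_ (IsClosed.inter ?_ ?_))) <;>
      exact isClosed_le (by fun_prop) (by fun_prop)

theorem vol_cube : volume (Set.Icc (0 : Fin 3 → ℝ) 1) = ENNReal.ofReal 1 := by
  rw [Real.volume_Icc_pi]; simp

/-- Change of variables `y ↦ (c i * (1 - ⟨y, v i⟩))`. -/
theorem vol_preimage (v : Fin 3 → Fin 3 → ℝ) (c : Fin 3 → ℝ) (hc : ∀ i, 0 < c i)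
    (hv : (Matrix.of v).det ≠ 0) (K : Set (Fin 3 → ℝ)) :
    volume {y : Fin 3 → ℝ | (fun i => c i * (1 - ∑ j, y j * v i j)) ∈ K} =
      ENNReal.ofReal (1 / (c 0 * c 1 * c 2 * |(Matrix.of v).det|)) * volume K := by
  set M : Matrix (Fin 3) (Fin 3) ℝ := Matrix.of fun i j => c i * v i j with hM
  have hdet : M.det = c 0 * c 1 * c 2 * (Matrix.of v).det := by
    simp only [hM, Matrix.det_fin_three, Matrix.of_apply]; ring
  have h0 := hc 0
  have h1 := hc 1
  have h2 := hc 2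
  have hdet0 : LinearMap.det (Matrix.toLin' M) ≠ 0 := by
    rw [LinearMap.det_toLin', hdet]; positivity
  have hset : {y : Fin 3 → ℝ | (fun i => c i * (1 - ∑ j, y j * v i j)) ∈ K}
      = (Matrix.toLin' M) ⁻¹' ((fun x => c - x) ⁻¹' K) := by
    ext y
    simp only [Set.mem_ofPred_eq, Set.mem_preimage]
    have : (fun i => c i * (1 - ∑ j, y j * v i j)) = c - Matrix.toLin' M y := by
      funext i
      simp only [hM, Pi.sub_apply, Matrix.toLin'_apply, Matrix.mulVec, dotProduct,
        Matrix.of_apply, Fin.sum_univ_three]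
      ring
    rw [this]
  have hpre : volume ((fun x => c - x) ⁻¹' K) = volume K :=
    (Measure.measurePreserving_sub_left volume c).measure_preimage_emb
      (MeasurableEquiv.subLeft c).measurableEmbedding K
  rw [hset, Measure.addHaar_preimage_linearMap _ hdet0, hpre,
    LinearMap.det_toLin', hdet, abs_inv, abs_mul, abs_of_pos (by positivity : 0 < c 0 * c 1 * c 2),
    one_div]

/-! ### Conic Carathéodory and circuits -/

theorem conic_caratheodory {ι E : Type*} [AddCommGroup E] [Module ℝ E] [DecidableEq ι]
    (f : ι → E) : ∀ (N : ℕ) (S : Finset ι) (c : ι → ℝ), S.card = N → (∀ i ∈ S, 0 ≤ c i) →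
    ∃ T ⊆ S, ∃ d : ι → ℝ, (∀ i ∈ T, 0 < d i) ∧ ∑ i ∈ T, d i • f i = ∑ i ∈ S, c i • f i ∧
      LinearIndepOn ℝ f (T : Set ι) := by
  intro N
  induction N with
  | zero =>
    intro S c hS _
    rw [Finset.card_eq_zero] at hS
    subst hS
    exact ⟨∅, by simp, c, by simp, by simp, by simp⟩
  | succ N ih =>
    intro S c hS hc
    have key : ∀ (k : ι → ℝ) (i₀ : ι), i₀ ∈ S → k i₀ = 0 → (∀ i ∈ S, 0 ≤ k i) →
        ∑ i ∈ S, k i • f i = ∑ i ∈ S, c i • f i →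
        ∃ T ⊆ S, ∃ d : ι → ℝ, (∀ i ∈ T, 0 < d i) ∧ ∑ i ∈ T, d i • f i = ∑ i ∈ S, c i • f i ∧
          LinearIndepOn ℝ f (T : Set ι) := by
      intro k i₀ hi₀ hk0 hk hsum
      obtain ⟨T, hT, d, hd, hs, hl⟩ := ih (S.erase i₀) k (by rw [Finset.card_erase_of_mem hi₀, hS]; rfl)
        (fun i hi => hk i (Finset.mem_of_mem_erase hi))
      refine ⟨T, hT.trans (Finset.erase_subset _ _), d, hd, ?_, hl⟩
      rw [hs, ← hsum]
      exact Finset.sum_erase _ (by rw [hk0, zero_smul])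
    by_cases hz : ∃ i ∈ S, c i = 0
    · obtain ⟨i, hi, hci⟩ := hz
      exact key c i hi hci hc rfl
    by_cases hl : LinearIndepOn ℝ f (S : Set ι)
    · refine ⟨S, subset_rfl, c, fun i hi => lt_of_le_of_ne (hc i hi) ?_, rfl, hl⟩
      intro h
      exact hz ⟨i, hi, h.symm⟩
    have : ∃ g : ι → ℝ, ∑ i ∈ S, g i • f i = 0 ∧ ∃ i ∈ S, 0 < g i := by
      rw [linearIndepOn_finset_iff] at hl
      push Not at hl
      obtain ⟨g, hg, i, hi, hgi⟩ := hl
      rcases lt_or_gt_of_ne hgi with h | h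
      · refine ⟨-g, ?_, i, hi, by simpa using h⟩
        simp [hg]
      · exact ⟨g, hg, i, hi, h⟩
    obtain ⟨g, hg, x, hx, hgx⟩ := this
    obtain ⟨i₀, mem, w⟩ : ∃ i₀ ∈ S.filter (fun z => 0 < g z),
        ∀ i ∈ S.filter (fun z => 0 < g z), c i₀ / g i₀ ≤ c i / g i :=
      Finset.exists_min_image _ (fun z => c z / g z) ⟨x, Finset.mem_filter.2 ⟨hx, hgx⟩⟩
    rw [Finset.mem_filter] at mem
    have hq : 0 ≤ c i₀ / g i₀ := div_nonneg (hc _ mem.1) mem.2.le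
    refine key (fun z => c z - c i₀ / g i₀ * g z) i₀ mem.1 ?_ ?_ ?_
    · have := mem.2.ne'
      field_simp
      simp
    · intro i hi
      rw [sub_nonneg]
      by_cases h : 0 < g i
      · rw [← le_div_iff₀ h]
        exact w i (Finset.mem_filter.2 ⟨hi, h⟩)
      · exact (mul_nonpos_of_nonneg_of_nonpos hq (not_lt.1 h)).trans (hc i hi)
    · simp only [sub_smul, mul_smul, Finset.sum_sub_distrib, ← Finset.smul_sum, hg, smul_zero,
        sub_zero]

/-- A positive circuit of lattice points of `V`: a positive relation, unique up to scaling. -/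
structure Circ (V : Finset (Fin 3 → ℤ)) {n : ℕ} (w : Fin n → Fin 3 → ℤ) (b : Fin n → ℝ) : Prop where
  mem : ∀ i, w i ∈ V
  pos : ∀ i, 0 < b i
  sum : ∑ i, b i = 1
  rel : ∑ i, b i • castPt (w i) = 0
  uniq : ∀ g : Fin n → ℝ, ∑ i, g i • castPt (w i) = 0 → ∃ c, ∀ i, g i = c * b i

theorem Circ.perm {V : Finset (Fin 3 → ℤ)} {n : ℕ} {w : Fin n → Fin 3 → ℤ} {b : Fin n → ℝ}
    (h : Circ V w b) (σ : Equiv.Perm (Fin n)) : Circ V (w ∘ σ) (b ∘ σ) := by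
  refine ⟨fun i => h.mem _, fun i => h.pos _, ?_, ?_, ?_⟩
  · rw [← h.sum]; exact Equiv.sum_comp σ b
  · rw [← h.rel]; exact Equiv.sum_comp σ (fun i => b i • castPt (w i))
  · intro g hg
    obtain ⟨c, hc⟩ := h.uniq (g ∘ σ.symm) (by
      rw [← hg, ← Equiv.sum_comp σ]
      simp)
    exact ⟨c, fun i => by simpa using hc (σ i)⟩

theorem Circ.sorted {V : Finset (Fin 3 → ℤ)} {n : ℕ} {w : Fin n → Fin 3 → ℤ} {b : Fin n → ℝ}
    (h : Circ V w b) : ∃ σ : Equiv.Perm (Fin n), Circ V (w ∘ σ) (b ∘ σ) ∧ Antitone (b ∘ σ) := by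
  refine ⟨Tuple.sort (fun i => - b i), h.perm _, ?_⟩
  intro i j hij
  have := Tuple.monotone_sort (fun i => - b i) hij
  simpa using this

theorem castPt_injective : Function.Injective (castPt : (Fin 3 → ℤ) → Fin 3 → ℝ) := by
  intro a b h
  funext i
  have := congrFun h i
  simpa [castPt] using this

theorem exists_circ (V : Finset (Fin 3 → ℤ))
    (h0 : (0 : Fin 3 → ℝ) ∈ interior (convexHull ℝ (castPt '' (V : Set (Fin 3 → ℤ)))))
    (v : Fin 3 → ℤ) (hv : v ∈ V) :
    ∃ n ≤ 3, ∃ (w : Fin (n + 1) → Fin 3 → ℤ) (b : Fin (n + 1) → ℝ), Circ V w b ∧ w 0 = v := by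
  classical
  set P := convexHull ℝ (castPt '' (V : Set (Fin 3 → ℤ))) with hP
  -- a small negative multiple of v lies in P
  obtain ⟨ε, hε, hεP⟩ : ∃ ε : ℝ, 0 < ε ∧ -(ε • castPt v) ∈ P := by
    have hcont : Filter.Tendsto (fun ε : ℝ => -(ε • castPt v)) (nhds 0) (nhds (0 : Fin 3 → ℝ)) := by
      have : Continuous (fun ε : ℝ => -(ε • castPt v)) := by fun_prop
      simpa using this.tendsto 0
    have := hcont.eventually (mem_interior_iff_mem_nhds.1 h0)
    have h2 := (this.filter_mono (nhdsWithin_le_nhds (s := Set.Ioi 0))).and self_mem_nhdsWithin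
    obtain ⟨ε, h, h'⟩ := h2.exists
    exact ⟨ε, h', h⟩
  -- write it as a combination
  obtain ⟨c, hc, hcs⟩ : ∃ c : (Fin 3 → ℤ) → ℝ, (∀ i ∈ V, 0 ≤ c i) ∧
      ∑ i ∈ V, c i • castPt i = -(ε • castPt v) := by
    have himg : castPt '' (V : Set (Fin 3 → ℤ)) = ((V.image castPt : Finset (Fin 3 → ℝ)) : Set _) := by
      simp
    rw [hP, himg, Finset.mem_convexHull'] at hεP
    obtain ⟨c, hc, -, hcs⟩ := hεP
    refine ⟨fun i => c (castPt i), fun i hi => hc _ (Finset.mem_image_of_mem _ hi), ?_⟩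
    rw [← hcs, Finset.sum_image]
    intro a _ b _ h
    exact castPt_injective h
  obtain ⟨T, hTV, d, hd, hds, hl⟩ := conic_caratheodory castPt _ V c rfl hc
  rw [hcs] at hds
  have hl' : LinearIndependent ℝ (fun i : T => castPt (i : Fin 3 → ℤ)) := hl
  have hcard : T.card ≤ 3 := by
    have := hl'.fintype_card_le_finrank
    simpa using this
  refine ⟨T.card, hcard, ?_⟩
  set e := T.equivFin.symm with he
  set tot : ℝ := ε + ∑ i ∈ T, d i with htot
  have htot0 : 0 < tot := add_pos_of_pos_of_nonneg hε (Finset.sum_nonneg fun i hi => (hd i hi).le)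
  have hT1 : ∀ {M : Type} [AddCommMonoid M] (F : (Fin 3 → ℤ) → M),
      ∑ i : Fin T.card, F (e i) = ∑ i ∈ T, F i := by
    intro M _ F
    rw [Equiv.sum_comp e (fun i : T => F i), Finset.sum_coe_sort]
  refine ⟨Fin.cons v (fun i => (e i : Fin 3 → ℤ)),
    Fin.cons (ε / tot) (fun i => d (e i) / tot), ⟨?_, ?_, ?_, ?_, ?_⟩, rfl⟩
  · intro i
    refine Fin.cases ?_ (fun i => ?_) i
    · exact hv
    · exact hTV (e i).2
  · intro i
    refine Fin.cases ?_ (fun i => ?_) i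
    · exact div_pos hε htot0
    · exact div_pos (hd _ (e i).2) htot0
  · rw [Fin.sum_univ_succ]
    simp only [Fin.cons_zero, Fin.cons_succ]
    rw [hT1 (fun i => d i / tot), ← Finset.sum_div, ← add_div]
    exact div_self htot0.ne'
  · rw [Fin.sum_univ_succ]
    simp only [Fin.cons_zero, Fin.cons_succ]
    rw [hT1 (fun i => (d i / tot) • castPt i)]
    have : ∑ i ∈ T, (d i / tot) • castPt i = tot⁻¹ • ∑ i ∈ T, d i • castPt i := by
      rw [Finset.smul_sum]
      refine Finset.sum_congr rfl fun i _ => ?_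
      rw [smul_smul]; congr 1; ring
    rw [this, hds, smul_neg, smul_smul]
    have h3 : tot⁻¹ * ε = ε / tot := by ring
    rw [h3, add_neg_cancel]
  · intro g hg
    refine ⟨g 0 * tot / ε, ?_⟩
    rw [Fin.sum_univ_succ] at hg
    simp only [Fin.cons_zero, Fin.cons_succ] at hg
    have hl2 : LinearIndependent ℝ (fun i : Fin T.card => castPt (e i : Fin 3 → ℤ)) :=
      hl'.comp _ e.injective
    rw [Fintype.linearIndependent_iff] at hl2
    have h2 := hl2 (fun i => g i.succ - g 0 / ε * d (e i)) (by
      simp only [sub_smul, mul_smul, Finset.sum_sub_distrib, ← Finset.smul_sum]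
      rw [hT1 (fun i => d i • castPt i), hds, smul_neg, smul_smul, div_mul_cancel₀ _ hε.ne',
        sub_neg_eq_add, add_comm, hg])
    intro i
    refine Fin.cases ?_ (fun i => ?_) i
    · simp only [Fin.cons_zero]
      field_simp
    · simp only [Fin.cons_succ]
      have := h2 i
      rw [sub_eq_zero] at this
      rw [this]
      field_simp

/-! ### Determinants of lattice vectors -/

/-- determinant of three lattice vectors -/
def dt (a b c : Fin 3 → ℤ) : ℤ := (Matrix.of ![a, b, c]).det

theorem dt_expand (a b c : Fin 3 → ℤ) : dt a b c =
    a 0 * b 1 * c 2 - a 0 * b 2 * c 1 - a 1 * b 0 * c 2 + a 1 * b 2 * c 0 + a 2 * b 0 * c 1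
      - a 2 * b 1 * c 0 := by
  simp [dt, Matrix.det_fin_three]

theorem dt_zero (a b c : Fin 3 → ℤ) (h : dt a b c = 0) : ∃ x y z : ℝ,
    ¬ (x = 0 ∧ y = 0 ∧ z = 0) ∧ x • castPt a + y • castPt b + z • castPt c = 0 := by
  have : (Matrix.of ![castPt a, castPt b, castPt c]).det = 0 := by
    have h2 : (Matrix.of ![castPt a, castPt b, castPt c]).det = ((dt a b c : ℤ) : ℝ) := by
      rw [dt_expand]
      simp [Matrix.det_fin_three, castPt]
    rw [h2, h]; simp
  obtain ⟨g, hg, hg0⟩ := Matrix.exists_vecMul_eq_zero_iff.2 this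
  refine ⟨g 0, g 1, g 2, ?_, ?_⟩
  · rintro ⟨h0, h1, h2⟩
    apply hg
    funext i
    fin_cases i <;> assumption
  · funext j
    have := congrFun hg0 j
    simpa [Matrix.vecMul, dotProduct, Fin.sum_univ_three] using this

theorem dt_lin {n : ℕ} (a b : Fin 3 → ℤ) (x : Fin n → Fin 3 → ℤ) (g : Fin n → ℝ)
    (h : ∑ i, g i • castPt (x i) = 0) : ∑ i, g i * (dt a b (x i) : ℝ) = 0 := by
  have hj : ∀ j, ∑ i, g i * (x i j : ℝ) = 0 := by
    intro j
    have := congrFun h j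
    simpa [castPt] using this
  have e : ∀ i, g i * (dt a b (x i) : ℝ) = (a 1 * b 2 - a 2 * b 1 : ℝ) * (g i * x i 0)
      + (a 2 * b 0 - a 0 * b 2 : ℝ) * (g i * x i 1) + (a 0 * b 1 - a 1 * b 0 : ℝ) * (g i * x i 2) := by
    intro i
    rw [dt_expand]; push_cast; ring
  simp_rw [e, Finset.sum_add_distrib, ← Finset.mul_sum, hj]
  simp

/-! ### The bound -/

/-- The hull of a finite set of lattice points. -/
def hull (V : Finset (Fin 3 → ℤ)) : Set (Fin 3 → ℝ) :=
  convexHull ℝ (castPt '' (V : Set (Fin 3 → ℤ)))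

theorem mem_hull {V : Finset (Fin 3 → ℤ)} {v : Fin 3 → ℤ} (h : v ∈ V) : castPt v ∈ hull V :=
  subset_convexHull _ _ ⟨v, h, rfl⟩

theorem dual_bound (V : Finset (Fin 3 → ℤ)) (a b c : Fin 3 → ℤ) (hd : dt a b c ≠ 0)
    (p q r : ℝ) (hp : 0 < p) (hq : 0 < q) (hr : 0 < r) (K : Set (Fin 3 → ℝ)) (κ : ℝ)
    (hK : volume K = ENNReal.ofReal κ) (hκ : 0 ≤ κ) (hb : 12 * κ ≤ 243 * (p * q * r))
    (hsub : ∀ y ∈ dualPolytope (hull V), ![p * (1 - ∑ j, y j * castPt a j),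
      q * (1 - ∑ j, y j * castPt b j), r * (1 - ∑ j, y j * castPt c j)] ∈ K) :
    6 * (volume (dualPolytope (hull V))).toReal ≤ 243 / 2 := by
  have hD : (Matrix.of ![castPt a, castPt b, castPt c]).det = ((dt a b c : ℤ) : ℝ) := by
    rw [dt_expand]
    simp [Matrix.det_fin_three, castPt]
  have hD1 : (1 : ℝ) ≤ |((dt a b c : ℤ) : ℝ)| := by
    rw [← Int.cast_abs]
    exact_mod_cast Int.one_le_abs hd
  have hpos : 0 < p * q * r := by positivity
  have hv := vol_preimage ![castPt a, castPt b, castPt c] ![p, q, r]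
    (by intro i; fin_cases i <;> assumption)
    (by rw [hD]; exact_mod_cast hd) K
  rw [hD, hK, ← ENNReal.ofReal_mul (by
    simp only [Matrix.cons_val]; positivity)] at hv
  have hle : volume (dualPolytope (hull V)) ≤ ENNReal.ofReal
      (1 / (p * q * r * |((dt a b c : ℤ) : ℝ)|) * κ) := by
    rw [show (1 / (p * q * r * |((dt a b c : ℤ) : ℝ)|) * κ) = _ from rfl]
    refine le_trans (measure_mono ?_) hv.le
    intro y hy
    have := hsub y hy
    simp only [Set.mem_ofPred_eq]
    convert this using 1
    funext i
    fin_cases i <;> rfl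
  have h1 : (volume (dualPolytope (hull V))).toReal ≤ 1 / (p * q * r * |((dt a b c : ℤ) : ℝ)|) * κ := by
    have := ENNReal.toReal_mono ENNReal.ofReal_ne_top hle
    rwa [ENNReal.toReal_ofReal (by positivity)] at this
  have h2 : 1 / (p * q * r * |((dt a b c : ℤ) : ℝ)|) * κ ≤ 1 / (p * q * r) * κ := by
    apply mul_le_mul_of_nonneg_right _ hκ
    apply one_div_le_one_div_of_le hpos
    exact le_mul_of_one_le_right hpos.le hD1
  have h3 : 1 / (p * q * r) * κ ≤ 243 / 12 := by
    rw [one_div, inv_mul_eq_div, div_le_iff₀ hpos]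
    linarith
  linarith

theorem dual_nonneg {V : Finset (Fin 3 → ℤ)} {n : ℕ} {w : Fin n → Fin 3 → ℤ} {b : Fin n → ℝ}
    (C : Circ V w b) {y : Fin 3 → ℝ} (hy : y ∈ dualPolytope (hull V)) (i : Fin n) :
    0 ≤ b i * (1 - ∑ j, y j * castPt (w i) j) := by
  apply mul_nonneg (C.pos i).le
  have := hy _ (mem_hull (C.mem i))
  linarith

theorem dual_sum {V : Finset (Fin 3 → ℤ)} {n : ℕ} {w : Fin n → Fin 3 → ℤ} {b : Fin n → ℝ}
    (C : Circ V w b) (y : Fin 3 → ℝ) :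
    ∑ i, b i * (1 - ∑ j, y j * castPt (w i) j) = 1 := by
  simp only [mul_sub, mul_one, Finset.sum_sub_distrib, C.sum]
  have hj : ∀ j, ∑ i, b i * castPt (w i) j = 0 := by
    intro j
    have := congrFun C.rel j
    simpa using this
  have : ∑ i, b i * ∑ j, y j * castPt (w i) j = ∑ j, y j * ∑ i, b i * castPt (w i) j := by
    simp_rw [Finset.mul_sum]
    rw [Finset.sum_comm]
    refine Finset.sum_congr rfl fun j _ => Finset.sum_congr rfl fun i _ => by ring
  rw [this]
  simp [hj]

theorem interior_pt {V : Finset (Fin 3 → ℤ)} (h0 : (0 : Fin 3 → ℝ) ∈ interior (hull V))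
    {n : ℕ} {w : Fin n → Fin 3 → ℤ} {b : Fin n → ℝ}
    (C : Circ V w b) (m : Fin n → ℤ) (k : ℤ) (hm : ∀ i, (m i : ℝ) < k * b i)
    (hs : ∑ i, m i = k - 1) : (-∑ i, m i • w i) ∈ intLatPts (hull V) := by
  set l : Fin n → ℝ := fun i => k * b i - m i with hl
  have hl0 : ∀ i, 0 < l i := fun i => sub_pos.2 (hm i)
  have hls : ∑ i, l i = 1 := by
    simp only [hl, Finset.sum_sub_distrib, ← Finset.mul_sum, C.sum]
    have : (∑ i, (m i : ℝ)) = (k : ℝ) - 1 := by exact_mod_cast hs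
    rw [this]; ring
  have hx : castPt (-∑ i, m i • w i) = ∑ i, l i • castPt (w i) := by
    simp only [hl, sub_smul, mul_smul, Finset.sum_sub_distrib, ← Finset.smul_sum, C.rel]
    funext j
    simp [castPt]
  obtain ⟨ε, ⟨hε1, hε2⟩, hε0⟩ : ∃ ε : ℝ, ((∀ i, ε * b i < l i) ∧ ε < 1) ∧ 0 < ε := by
    have h1 : ∀ᶠ ε in nhds (0:ℝ), (∀ i, ε * b i < l i) ∧ ε < 1 := by
      refine Filter.Eventually.and ?_ (eventually_lt_nhds one_pos)
      rw [Filter.eventually_all]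
      intro i
      have hc : Continuous (fun ε : ℝ => ε * b i) := by fun_prop
      have := hc.tendsto 0
      rw [zero_mul] at this
      exact this.eventually (eventually_lt_nhds (hl0 i))
    have h2 := (h1.filter_mono (nhdsWithin_le_nhds (s := Set.Ioi 0))).and self_mem_nhdsWithin
    exact h2.exists
  have h1ε : 0 < 1 - ε := by linarith
  have ht : ∑ i, ((l i - ε * b i) / (1 - ε)) • castPt (w i) ∈ hull V := by
    apply (convex_convexHull ℝ _).sum_mem
    · intro i _
      exact div_nonneg (by linarith [hε1 i]) h1ε.le
    · rw [← Finset.sum_div, Finset.sum_sub_distrib, ← Finset.mul_sum, hls, C.sum, mul_one]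
      exact div_self h1ε.ne'
    · intro i _
      exact mem_hull (C.mem i)
  have hconv : Convex ℝ (hull V) := convex_convexHull ℝ _
  have := hconv.combo_interior_self_mem_interior h0 ht hε0 h1ε.le (by ring)
  change castPt _ ∈ interior _
  rw [hx]
  convert this using 1
  rw [smul_zero, zero_add, Finset.smul_sum]
  have : ∀ i, (1 - ε) • ((l i - ε * b i) / (1 - ε)) • castPt (w i)
      = l i • castPt (w i) - ε • (b i • castPt (w i)) := by
    intro i
    rw [smul_smul, mul_div_cancel₀ _ h1ε.ne', sub_smul, mul_smul]
  simp_rw [this, Finset.sum_sub_distrib, ← Finset.smul_sum, C.rel]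
  simp

theorem exists_notMem {V : Finset (Fin 3 → ℤ)} (h0 : (0 : Fin 3 → ℝ) ∈ interior (hull V))
    (H : Submodule ℝ (Fin 3 → ℝ)) (hH : H ≠ ⊤) : ∃ u ∈ V, castPt u ∉ H := by
  by_contra hcon
  push Not at hcon
  apply hH
  apply H.eq_top_of_nonempty_interior'
  refine ⟨0, interior_mono ?_ h0⟩
  apply convexHull_min _ H.convex
  rintro _ ⟨u, hu, rfl⟩
  exact hcon u hu

theorem span_ne_top (s : Finset (Fin 3 → ℝ)) (hs : s.card ≤ 2) :
    Submodule.span ℝ (s : Set (Fin 3 → ℝ)) ≠ ⊤ := by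
  intro h
  have := finrank_span_finset_le_card (R := ℝ) s
  rw [Set.finrank, h, finrank_top] at this
  simp at this
  omega

theorem core_ineq (x y z t : ℝ) (ht : 0 < t) (s : x + y + z + t = 1) (o1 : y ≤ x) (o2 : z ≤ y)
    (o3 : t ≤ z) (e1 : x ≤ 2 / 3) (e2 : 1 / 2 < x → y ≤ 1 / 4) (e3 : 3 / 5 < x → y ≤ 1 / 5)
    (e4 : y ≤ 2 / 5) : 2 ≤ 243 * (x * y * z) := by
  have hz : (1 - x - y) / 2 ≤ z := by linarith
  have hx : 1 / 4 ≤ x := by linarith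
  have hy : 0 < y := by linarith
  have hyz : x * y * ((1 - x - y) / 2) ≤ x * y * z :=
    mul_le_mul_of_nonneg_left hz (by positivity)
  by_cases h : y ≤ 2 * (1 - x) / 3
  · have hl : (1 - x) / 3 ≤ y := by linarith
    have h1 : 2 * (1 - x) ^ 2 / 9 ≤ y * (1 - x - y) := by
      nlinarith [mul_nonneg (sub_nonneg.2 hl) (sub_nonneg.2 h)]
    have h2 : x * (2 * (1 - x) ^ 2 / 9) ≤ x * (y * (1 - x - y)) :=
      mul_le_mul_of_nonneg_left h1 (by linarith)
    have h3 : 2 / 27 ≤ x * (1 - x) ^ 2 := by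
      nlinarith [mul_nonneg (sub_nonneg.2 e1) (sub_nonneg.2 hx),
        mul_nonneg (mul_nonneg (sub_nonneg.2 e1) (sub_nonneg.2 hx)) (sub_nonneg.2 e1)]
    linarith
  · push Not at h
    have hx2 : x ≤ 1 / 2 := by
      by_contra hc
      push Not at hc
      have := e2 hc
      by_cases h35 : 3 / 5 < x
      · have := e3 h35
        linarith
      · linarith
    have hy3 : 1 / 3 < y := by linarith
    have h1 : 1 / 20 ≤ x * (1 - x - y) := by
      nlinarith [mul_nonneg (sub_nonneg.2 o1) (sub_nonneg.2 hx2),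
        mul_nonneg (sub_nonneg.2 hx2) (sub_nonneg.2 hy3.le)]
    have h2 : y * (1 / 20) ≤ y * (x * (1 - x - y)) := mul_le_mul_of_nonneg_left h1 hy.le
    linarith

section
variable {V : Finset (Fin 3 → ℤ)}

theorem case_a (h0 : (0 : Fin 3 → ℝ) ∈ interior (hull V))
    (h2 : ∀ p ∈ intLatPts (hull V), ∀ q ∈ intLatPts (hull V), p ≠ 0 → q ≠ 0 → p = q)
    {w : Fin 4 → Fin 3 → ℤ} {b : Fin 4 → ℝ} (C : Circ V w b) (hb : Antitone b) :
    6 * (volume (dualPolytope (hull V))).toReal ≤ 243 / 2 := by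
  have p0 := C.pos 0
  have p1 := C.pos 1
  have p2 := C.pos 2
  have p3 := C.pos 3
  have s := C.sum
  rw [Fin.sum_univ_four] at s
  have o1 : b 1 ≤ b 0 := hb (by decide)
  have o2 : b 2 ≤ b 1 := hb (by decide)
  have o3 : b 3 ≤ b 2 := hb (by decide)
  -- independence
  have ind : ∀ x y z : ℝ, x • castPt (w 0) + y • castPt (w 1) + z • castPt (w 2) = 0 →
      x = 0 ∧ y = 0 ∧ z = 0 := by
    intro x y z h
    obtain ⟨c, hc⟩ := C.uniq ![x, y, z, 0] (by simpa [Fin.sum_univ_four] using h)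
    have c3 := hc 3
    simp at c3
    have hc0 : c = 0 := by rcases c3 with h | h; exact h; linarith
    subst hc0
    exact ⟨by simpa using hc 0, by simpa using hc 1, by simpa using hc 2⟩
  have indZ : ∀ x y : ℤ, x • w 0 + y • w 1 = 0 → x = 0 ∧ y = 0 := by
    intro x y h
    have := ind x y 0 (by
      funext j
      have := congrFun h j
      simp [castPt] at this ⊢
      exact_mod_cast this)
    exact ⟨by exact_mod_cast this.1, by exact_mod_cast this.2.1⟩
  -- lattice points from pairs
  have pt : ∀ (k x y : ℤ), (x : ℝ) < k * b 0 → (y : ℝ) < k * b 1 → 0 < k → x + y = k - 1 →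
      -(x • w 0 + y • w 1) ∈ intLatPts (hull V) := by
    intro k x y hx hy hk hxy
    have hk' : (0:ℝ) < k := by exact_mod_cast hk
    have := interior_pt h0 C ![x, y, 0, 0] k (by
      intro i
      fin_cases i
      · simpa using hx
      · simpa using hy
      · simpa using mul_pos hk' p2
      · simpa using mul_pos hk' p3) (by simpa [Fin.sum_univ_four] using hxy)
    simpa [Fin.sum_univ_four] using this
  have two : ∀ (k x y k' x' y' : ℤ), (x : ℝ) < k * b 0 → (y : ℝ) < k * b 1 → 0 < k →
      x + y = k - 1 → (x' : ℝ) < k' * b 0 → (y' : ℝ) < k' * b 1 → 0 < k' →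
      x' + y' = k' - 1 → 0 < x → 0 < x' → x ≠ x' → False := by
    intro k x y k' x' y' a1 a2 a3 a4 b1 b2 b3 b4 hx hx' hne
    have hp := pt k x y a1 a2 a3 a4
    have hq := pt k' x' y' b1 b2 b3 b4
    have := h2 _ hp _ hq (by
        intro h
        rw [neg_eq_zero] at h
        have := indZ _ _ h
        omega) (by
        intro h
        rw [neg_eq_zero] at h
        have := indZ _ _ h
        omega)
    have h3 := indZ (x - x') (y - y') (by
      rw [neg_inj] at this
      rw [sub_smul, sub_smul, sub_add_sub_comm, this, sub_self])
    omega
  have e1 : b 0 ≤ 2 / 3 := by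
    by_contra h
    push Not at h
    refine two 2 1 0 3 2 0 ?_ ?_ ?_ ?_ ?_ ?_ ?_ ?_ ?_ ?_ ?_ <;> push_cast <;> first | linarith | norm_num
  have e2 : 1 / 2 < b 0 → b 1 ≤ 1 / 4 := by
    intro h'
    by_contra h
    push Not at h
    refine two 2 1 0 4 2 1 ?_ ?_ ?_ ?_ ?_ ?_ ?_ ?_ ?_ ?_ ?_ <;> push_cast <;> first | linarith | norm_num
  have e3 : 3 / 5 < b 0 → b 1 ≤ 1 / 5 := by
    intro h'
    by_contra h
    push Not at h
    refine two 2 1 0 5 3 1 ?_ ?_ ?_ ?_ ?_ ?_ ?_ ?_ ?_ ?_ ?_ <;> push_cast <;> first | linarith | norm_num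
  have e4 : b 1 ≤ 2 / 5 := by
    by_contra h
    push Not at h
    refine two 3 1 1 5 2 2 ?_ ?_ ?_ ?_ ?_ ?_ ?_ ?_ ?_ ?_ ?_ <;> push_cast <;> first | linarith | norm_num
  have hdt : dt (w 0) (w 1) (w 2) ≠ 0 := by
    intro h
    obtain ⟨x, y, z, hn, h⟩ := dt_zero _ _ _ h
    exact hn (ind x y z h)
  refine dual_bound V (w 0) (w 1) (w 2) hdt (b 0) (b 1) (b 2) p0 p1 p2 bodySimplex (1 / 6)
    vol_simplex (by norm_num) ?_ ?_
  · have := core_ineq (b 0) (b 1) (b 2) (b 3) p3 s o1 o2 o3 e1 e2 e3 e4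
    linarith
  · intro y hy
    have t0 := dual_nonneg C hy 0
    have t1 := dual_nonneg C hy 1
    have t2 := dual_nonneg C hy 2
    have t3 := dual_nonneg C hy 3
    have ts := dual_sum C y
    rw [Fin.sum_univ_four] at ts
    simp only [bodySimplex, Set.mem_ofPred_eq, Matrix.cons_val]
    exact ⟨t0, t1, t2, by linarith⟩
end

section
variable {V : Finset (Fin 3 → ℤ)}

theorem circ3_indep {w : Fin 3 → Fin 3 → ℤ} {b : Fin 3 → ℝ} (C : Circ V w b) (x y : ℝ)
    (h : x • castPt (w 0) + y • castPt (w 1) = 0) : x = 0 ∧ y = 0 := by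
  obtain ⟨c, hc⟩ := C.uniq ![x, y, 0] (by simpa [Fin.sum_univ_three] using h)
  have c3 := hc 2
  simp at c3
  have hc0 : c = 0 := by
    rcases c3 with h | h
    · exact h
    · exact absurd h (C.pos 2).ne'
  subst hc0
  exact ⟨by simpa using hc 0, by simpa using hc 1⟩

theorem circ3_ne {w : Fin 3 → Fin 3 → ℤ} {b : Fin 3 → ℝ} (C : Circ V w b) : w 0 ≠ 0 := by
  intro h
  have := circ3_indep C 1 0 (by
    rw [h]; funext j; simp [castPt])
  exact one_ne_zero this.1

theorem circ3_neg (h0 : (0 : Fin 3 → ℝ) ∈ interior (hull V))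
    {w : Fin 3 → Fin 3 → ℤ} {b : Fin 3 → ℝ} (C : Circ V w b) (h : 1 / 2 < b 0) :
    -w 0 ∈ intLatPts (hull V) := by
  have p1 := C.pos 1
  have p2 := C.pos 2
  have := interior_pt h0 C ![1, 0, 0] 2 (by
    intro i
    fin_cases i <;> simp <;> linarith) (by simp [Fin.sum_univ_three])
  simpa [Fin.sum_univ_three] using this

theorem circ3_le (h0 : (0 : Fin 3 → ℝ) ∈ interior (hull V))
    (h2 : ∀ p ∈ intLatPts (hull V), ∀ q ∈ intLatPts (hull V), p ≠ 0 → q ≠ 0 → p = q)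
    {w : Fin 3 → Fin 3 → ℤ} {b : Fin 3 → ℝ} (C : Circ V w b) : b 0 ≤ 2 / 3 := by
  by_contra h
  push Not at h
  have p1 := C.pos 1
  have p2 := C.pos 2
  have hp := circ3_neg h0 C (by linarith)
  have hq := interior_pt h0 C ![2, 0, 0] 3 (by
    intro i
    fin_cases i <;> simp <;> linarith) (by simp [Fin.sum_univ_three])
  simp [Fin.sum_univ_three] at hq
  have hne := circ3_ne C
  have := h2 _ hp _ hq (by simpa using hne) (by
    intro h
    apply hne
    funext j
    have := congrFun h j
    simp at this ⊢
    omega)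
  apply hne
  funext j
  have := congrFun this j
  simp at this ⊢
  omega

theorem circ3_facts (h0 : (0 : Fin 3 → ℝ) ∈ interior (hull V))
    (h2 : ∀ p ∈ intLatPts (hull V), ∀ q ∈ intLatPts (hull V), p ≠ 0 → q ≠ 0 → p = q)
    {w : Fin 3 → Fin 3 → ℤ} {b : Fin 3 → ℝ} (C : Circ V w b) (hb : Antitone b) :
    1 / 9 ≤ b 0 * b 1 ∧ (1 - b 0) / 2 ≤ b 1 ∧ 1 / 6 ≤ b 1 ∧ 1 / 3 ≤ b 0 := by
  have hle := circ3_le h0 h2 C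
  have s := C.sum
  rw [Fin.sum_univ_three] at s
  have o1 : b 1 ≤ b 0 := hb (by decide)
  have o2 : b 2 ≤ b 1 := hb (by decide)
  have h1 : (1 - b 0) / 2 ≤ b 1 := by linarith
  have h3 : 1 / 3 ≤ b 0 := by linarith
  refine ⟨?_, h1, by linarith, h3⟩
  have : b 0 * ((1 - b 0) / 2) ≤ b 0 * b 1 := mul_le_mul_of_nonneg_left h1 (by linarith)
  nlinarith [mul_nonneg (sub_nonneg.2 h3) (sub_nonneg.2 hle)]

theorem prism_bound (h0 : (0 : Fin 3 → ℝ) ∈ interior (hull V))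
    (h2 : ∀ p ∈ intLatPts (hull V), ∀ q ∈ intLatPts (hull V), p ≠ 0 → q ≠ 0 → p = q)
    {w : Fin 3 → Fin 3 → ℤ} {b : Fin 3 → ℝ} (C : Circ V w b) (hb : Antitone b)
    {n : ℕ} {x : Fin n → Fin 3 → ℤ} {g : Fin n → ℝ} (D : Circ V x g) (r : Fin n)
    (hr : 2 / 9 ≤ g r) (hd : dt (w 0) (w 1) (x r) ≠ 0) :
    6 * (volume (dualPolytope (hull V))).toReal ≤ 243 / 2 := by
  obtain ⟨f1, f2, f3, f4⟩ := circ3_facts h0 h2 C hb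
  refine dual_bound V (x r) (w 0) (w 1) ?_ (g r) (b 0) (b 1) (D.pos r) (C.pos 0) (C.pos 1)
    bodyPrism (1 / 2) vol_prism (by norm_num) ?_ ?_
  · intro h
    apply hd
    rw [← h, dt_expand, dt_expand]
    ring
  · have : 2 / 9 * (1 / 9) ≤ g r * (b 0 * b 1) :=
      mul_le_mul hr f1 (by norm_num) (by linarith)
    linarith
  · intro y hy
    have t0 := dual_nonneg C hy 0
    have t1 := dual_nonneg C hy 1
    have t2 := dual_nonneg C hy 2
    have ts := dual_sum C y
    rw [Fin.sum_univ_three] at ts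
    have u0 := dual_nonneg D hy r
    have u1 : g r * (1 - ∑ j, y j * castPt (x r) j) ≤ 1 := by
      refine le_trans ?_ (dual_sum D y).le
      exact Finset.single_le_sum (f := fun i => g i * (1 - ∑ j, y j * castPt (x i) j))
        (fun i _ => dual_nonneg D hy i) (Finset.mem_univ r)
    simp only [bodyPrism, Set.mem_ofPred_eq, Matrix.cons_val]
    exact ⟨u0, u1, t0, t1, by linarith⟩

theorem case_b3 (h0 : (0 : Fin 3 → ℝ) ∈ interior (hull V))
    (h2 : ∀ p ∈ intLatPts (hull V), ∀ q ∈ intLatPts (hull V), p ≠ 0 → q ≠ 0 → p = q)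
    {w : Fin 3 → Fin 3 → ℤ} {b : Fin 3 → ℝ} (C : Circ V w b) (hb : Antitone b)
    {x : Fin 3 → Fin 3 → ℤ} {g : Fin 3 → ℝ} (D : Circ V x g) (hg : Antitone g)
    (hd : ∃ i, dt (w 0) (w 1) (x i) ≠ 0) :
    6 * (volume (dualPolytope (hull V))).toReal ≤ 243 / 2 := by
  obtain ⟨f1, f2, f3, f4⟩ := circ3_facts h0 h2 C hb
  obtain ⟨k1, k2, k3, k4⟩ := circ3_facts h0 h2 D hg
  by_cases hx0 : dt (w 0) (w 1) (x 0) = 0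
  swap
  · exact prism_bound h0 h2 C hb D 0 (by linarith) hx0
  have hx1 : dt (w 0) (w 1) (x 1) ≠ 0 := by
    intro hx1
    have := dt_lin (w 0) (w 1) x g D.rel
    rw [Fin.sum_univ_three, hx0, hx1] at this
    simp [(D.pos 2).ne'] at this
    obtain ⟨i, hi⟩ := hd
    fin_cases i
    · exact hi hx0
    · exact hi hx1
    · exact hi this
  by_cases hg1 : 2 / 9 ≤ g 1
  · exact prism_bound h0 h2 C hb D 1 hg1 hx1
  push Not at hg1
  have hg0 : 5 / 9 < g 0 := by linarith
  by_cases hb0 : 1 / 2 < b 0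
  · -- common apex: pyramid
    have hxw : x 0 = w 0 := by
      have := h2 _ (circ3_neg h0 D (by linarith)) _ (circ3_neg h0 C hb0)
        (by simpa using circ3_ne D) (by simpa using circ3_ne C)
      exact neg_inj.1 this
    have p0 := C.pos 0
    have p1 := C.pos 1
    have q1 := D.pos 1
    refine dual_bound V (w 0) (w 1) (x 1) hx1 (min (b 0) (g 0)) (b 1) (g 1)
      (lt_min p0 (D.pos 0)) p1 q1 bodyPyramid (1 / 3) vol_pyramid (by norm_num) ?_ ?_
    · have : 1 / 54 ≤ min (b 0) (g 0) * b 1 * g 1 := by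
        rcases le_total (b 0) (g 0) with h | h
        · rw [min_eq_left h]
          have := mul_le_mul f1 k3 (by norm_num) (by positivity)
          linarith
        · rw [min_eq_right h]
          have := mul_le_mul k1 f3 (by norm_num) (by nlinarith)
          linarith
      linarith
    · intro y hy
      have t0 := dual_nonneg C hy 0
      have t1 := dual_nonneg C hy 1
      have t2 := dual_nonneg C hy 2
      have ts := dual_sum C y
      rw [Fin.sum_univ_three] at ts
      have u1 := dual_nonneg D hy 1
      have u2 := dual_nonneg D hy 2
      have us := dual_sum D y
      rw [Fin.sum_univ_three, hxw] at us
      have n0 : 0 ≤ 1 - ∑ j, y j * castPt (w 0) j := by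
        have := hy _ (mem_hull (C.mem 0))
        linarith
      have m1 := mul_le_mul_of_nonneg_right (min_le_left (b 0) (g 0)) n0
      have m2 := mul_le_mul_of_nonneg_right (min_le_right (b 0) (g 0)) n0
      have m0 := mul_nonneg (le_min p0.le (D.pos 0).le) n0
      simp only [bodyPyramid, Set.mem_ofPred_eq, Matrix.cons_val]
      exact ⟨m0, t1, u1, by linarith, by linarith⟩
  · push Not at hb0
    -- swap the roles
    by_cases ha : dt (x 0) (x 1) (w 0) = 0
    · by_cases hc : dt (x 0) (x 1) (w 1) = 0
      · exfalso
        obtain ⟨p, q, r, hn, h⟩ := dt_zero _ _ _ hx0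
        have r1 := dt_lin (x 1) (w 0) ![w 0, w 1, x 0] ![p, q, r]
          (by simpa [Fin.sum_univ_three] using h)
        have r2 := dt_lin (x 1) (w 1) ![w 0, w 1, x 0] ![p, q, r]
          (by simpa [Fin.sum_univ_three] using h)
        simp only [Fin.sum_univ_three, Matrix.cons_val] at r1 r2
        have e1 : dt (x 1) (w 0) (w 0) = 0 := by rw [dt_expand]; ring
        have e2 : dt (x 1) (w 0) (w 1) = dt (w 0) (w 1) (x 1) := by
          rw [dt_expand, dt_expand]; ring
        have e3 : dt (x 1) (w 0) (x 0) = 0 := by rw [← ha, dt_expand, dt_expand]; ring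
        have e4 : dt (x 1) (w 1) (w 1) = 0 := by rw [dt_expand]; ring
        have e5 : dt (x 1) (w 1) (w 0) = -dt (w 0) (w 1) (x 1) := by
          rw [dt_expand, dt_expand]; ring
        have e6 : dt (x 1) (w 1) (x 0) = 0 := by rw [← hc, dt_expand, dt_expand]; ring
        rw [e1, e2, e3] at r1
        rw [e4, e5, e6] at r2
        have hq0 : q = 0 := by simpa [hx1] using r1
        have hp0 : p = 0 := by simpa [hx1] using r2
        subst hq0 hp0
        have hr0 : r ≠ 0 := fun hr => hn ⟨rfl, rfl, hr⟩
        have := circ3_indep D r 0 (by simpa using h)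
        exact hr0 this.1
      · exact prism_bound h0 h2 D hg C 1 (by linarith) hc
    · exact prism_bound h0 h2 D hg C 0 (by linarith) ha

theorem case_b2 (h0 : (0 : Fin 3 → ℝ) ∈ interior (hull V))
    (h2 : ∀ p ∈ intLatPts (hull V), ∀ q ∈ intLatPts (hull V), p ≠ 0 → q ≠ 0 → p = q)
    {w : Fin 3 → Fin 3 → ℤ} {b : Fin 3 → ℝ} (C : Circ V w b) (hb : Antitone b)
    {x : Fin 2 → Fin 3 → ℤ} {g : Fin 2 → ℝ} (D : Circ V x g) (hg : Antitone g)
    (hd : ∃ i, dt (w 0) (w 1) (x i) ≠ 0) :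
    6 * (volume (dualPolytope (hull V))).toReal ≤ 243 / 2 := by
  have s := D.sum
  rw [Fin.sum_univ_two] at s
  have o : g 1 ≤ g 0 := hg (by decide)
  refine prism_bound h0 h2 C hb D 0 (by linarith) ?_
  intro hx0
  have := dt_lin (w 0) (w 1) x g D.rel
  rw [Fin.sum_univ_two, hx0] at this
  simp [(D.pos 1).ne'] at this
  obtain ⟨i, hi⟩ := hd
  fin_cases i
  · exact hi hx0
  · exact hi this

theorem case_b (h0 : (0 : Fin 3 → ℝ) ∈ interior (hull V))
    (h2 : ∀ p ∈ intLatPts (hull V), ∀ q ∈ intLatPts (hull V), p ≠ 0 → q ≠ 0 → p = q)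
    (h4 : ¬ ∃ (w : Fin 4 → Fin 3 → ℤ) (b : Fin 4 → ℝ), Circ V w b)
    {w : Fin 3 → Fin 3 → ℤ} {b : Fin 3 → ℝ} (C : Circ V w b) (hb : Antitone b) :
    6 * (volume (dualPolytope (hull V))).toReal ≤ 243 / 2 := by
  classical
  obtain ⟨u, hu, huH⟩ := exists_notMem h0 _ (span_ne_top {castPt (w 0), castPt (w 1)}
    Finset.card_le_two)
  have hdu : dt (w 0) (w 1) u ≠ 0 := by
    intro h
    obtain ⟨p, q, r, hn, h⟩ := dt_zero _ _ _ h
    by_cases hr : r = 0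
    · subst hr
      have := circ3_indep C p q (by simpa using h)
      exact hn ⟨this.1, this.2, rfl⟩
    · apply huH
      have e : castPt u = (-p / r) • castPt (w 0) + (-q / r) • castPt (w 1) := by
        funext j
        have := congrFun h j
        simp at this ⊢
        field_simp
        linarith
      rw [e]
      apply Submodule.add_mem <;> apply Submodule.smul_mem <;> apply Submodule.subset_span <;> simp
  obtain ⟨n, hn, x, g, D, hxu⟩ := exists_circ V h0 u hu
  obtain ⟨σ, D', hg⟩ := D.sorted
  have hi : ∃ i, dt (w 0) (w 1) ((x ∘ σ) i) ≠ 0 := ⟨σ.symm 0, by simpa [hxu] using hdu⟩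
  interval_cases n
  · exfalso
    apply hdu
    have := D.rel
    have s := D.sum
    simp at this s
    rw [s, hxu] at this
    replace this := this.resolve_left one_ne_zero
    have hu0 : u = 0 := castPt_injective (by rw [this]; funext j; simp [castPt])
    rw [hu0, dt_expand]; simp
  · exact case_b2 h0 h2 C hb D' hg hi
  · exact case_b3 h0 h2 C hb D' hg hi
  · exact (h4 ⟨x, g, D⟩).elim

theorem case_c_pick (h0 : (0 : Fin 3 → ℝ) ∈ interior (hull V))
    (h4 : ¬ ∃ (w : Fin 4 → Fin 3 → ℤ) (b : Fin 4 → ℝ), Circ V w b)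
    (h3 : ¬ ∃ (w : Fin 3 → Fin 3 → ℤ) (b : Fin 3 → ℝ), Circ V w b)
    (H : Submodule ℝ (Fin 3 → ℝ)) (hH : H ≠ ⊤) : ∃ (u : Fin 3 → ℤ) (c : ℝ), castPt u ∉ H ∧
      1 / 2 ≤ c ∧ ∀ y ∈ dualPolytope (hull V), 0 ≤ c * (1 - ∑ j, y j * castPt u j) ∧
        c * (1 - ∑ j, y j * castPt u j) ≤ 1 := by
  obtain ⟨u, hu, huH⟩ := exists_notMem h0 H hH
  obtain ⟨n, hn, x, g, D, hxu⟩ := exists_circ V h0 u hu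
  interval_cases n
  · exfalso
    apply huH
    have := D.rel
    have s := D.sum
    simp at this s
    rw [s, hxu] at this
    replace this := this.resolve_left one_ne_zero
    rw [this]
    exact H.zero_mem
  · have s := D.sum
    have rel := D.rel
    rw [Fin.sum_univ_two] at s rel
    have key : ∀ i, castPt (x i) ∉ H → 1 / 2 ≤ g i → ∃ (u : Fin 3 → ℤ) (c : ℝ), castPt u ∉ H ∧
      1 / 2 ≤ c ∧ ∀ y ∈ dualPolytope (hull V), 0 ≤ c * (1 - ∑ j, y j * castPt u j) ∧
        c * (1 - ∑ j, y j * castPt u j) ≤ 1 := by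
      intro i hi hgi
      refine ⟨x i, g i, hi, hgi, fun y hy => ⟨dual_nonneg D hy i, ?_⟩⟩
      refine le_trans ?_ (dual_sum D y).le
      exact Finset.single_le_sum (f := fun i => g i * (1 - ∑ j, y j * castPt (x i) j))
        (fun i _ => dual_nonneg D hy i) (Finset.mem_univ i)
    by_cases hg : 1 / 2 ≤ g 0
    · exact key 0 (by rw [hxu]; exact huH) hg
    · refine key 1 ?_ (by linarith)
      intro h1
      apply huH
      rw [← hxu]
      have : g 0 • castPt (x 0) = -(g 1 • castPt (x 1)) := eq_neg_of_add_eq_zero_left rel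
      have hm : g 0 • castPt (x 0) ∈ H := by
        rw [this]; exact H.neg_mem (H.smul_mem _ h1)
      exact (H.smul_mem_iff (D.pos 0).ne').1 hm
  · exact (h3 ⟨x, g, D⟩).elim
  · exact (h4 ⟨x, g, D⟩).elim

theorem case_c (h0 : (0 : Fin 3 → ℝ) ∈ interior (hull V))
    (h4 : ¬ ∃ (w : Fin 4 → Fin 3 → ℤ) (b : Fin 4 → ℝ), Circ V w b)
    (h3 : ¬ ∃ (w : Fin 3 → Fin 3 → ℤ) (b : Fin 3 → ℝ), Circ V w b) :
    6 * (volume (dualPolytope (hull V))).toReal ≤ 243 / 2 := by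
  classical
  obtain ⟨u, p, hu, hp, hup⟩ := case_c_pick h0 h4 h3 _ (span_ne_top ∅ (by simp))
  obtain ⟨v, q, hv, hq, hvq⟩ := case_c_pick h0 h4 h3 _ (span_ne_top {castPt u} (by simp))
  obtain ⟨w, r, hw, hr, hwr⟩ := case_c_pick h0 h4 h3 _ (span_ne_top {castPt u, castPt v}
    Finset.card_le_two)
  refine dual_bound V u v w ?_ p q r (by linarith) (by linarith) (by linarith)
    (Set.Icc 0 1) 1 vol_cube (by norm_num) ?_ ?_
  · intro h
    obtain ⟨a, b, c, hn, h⟩ := dt_zero _ _ _ h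
    by_cases hc : c = 0
    · subst hc
      by_cases hb : b = 0
      · subst hb
        have ha : a ≠ 0 := fun ha => hn ⟨ha, rfl, rfl⟩
        simp [ha] at h
        apply hu
        rw [h]
        exact Submodule.zero_mem _
      · apply hv
        have e : castPt v = (-a / b) • castPt u := by
          funext j
          have := congrFun h j
          simp at this ⊢
          field_simp
          linarith
        rw [e]
        apply Submodule.smul_mem; apply Submodule.subset_span; simp
    · apply hw
      have e : castPt w = (-a / c) • castPt u + (-b / c) • castPt v := by
        funext j
        have := congrFun h j
        simp at this ⊢
        field_simp
        linarith
      rw [e]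
      apply Submodule.add_mem <;> apply Submodule.smul_mem <;> apply Submodule.subset_span <;> simp
  · have h1 : 1 / 2 * (1 / 2) ≤ p * q := mul_le_mul hp hq (by norm_num) (by linarith)
    have h2 : 1 / 2 * (1 / 2) * (1 / 2) ≤ p * q * r :=
      mul_le_mul h1 hr (by norm_num) (by nlinarith)
    linarith
  · intro y hy
    have a1 := hup y hy
    have a2 := hvq y hy
    have a3 := hwr y hy
    rw [Set.mem_Icc, Pi.le_def, Pi.le_def]
    constructor
    · intro i
      fin_cases i
      · exact a1.1
      · exact a2.1
      · exact a3.1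
    · intro i
      fin_cases i
      · exact a1.2
      · exact a2.2
      · exact a3.2

theorem main_bound (h0 : (0 : Fin 3 → ℝ) ∈ interior (hull V))
    (h2 : ∀ p ∈ intLatPts (hull V), ∀ q ∈ intLatPts (hull V), p ≠ 0 → q ≠ 0 → p = q) :
    6 * (volume (dualPolytope (hull V))).toReal ≤ 243 / 2 := by
  by_cases h4 : ∃ (w : Fin 4 → Fin 3 → ℤ) (b : Fin 4 → ℝ), Circ V w b
  · obtain ⟨w, b, C⟩ := h4
    obtain ⟨σ, C', hb⟩ := C.sorted
    exact case_a h0 h2 C' hb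
  by_cases h3 : ∃ (w : Fin 3 → Fin 3 → ℤ) (b : Fin 3 → ℝ), Circ V w b
  · obtain ⟨w, b, C⟩ := h3
    obtain ⟨σ, C', hb⟩ := C.sorted
    exact case_b h0 h2 h4 C' hb
  exact case_c h0 h4 h3
end

/-! ### The extremal simplex -/

/-- vertices of the extremal simplex -/
def Vmax : Finset (Fin 3 → ℤ) := {![-1,-1,-1], ![0,-1,-1], ![-1,0,-1], ![7,7,8]}

theorem Pmax_eq : Pmax = hull Vmax := by
  unfold Pmax hull
  congr 1
  simp only [Vmax, Finset.coe_insert, Finset.coe_singleton, Set.image_insert_eq,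
    Set.image_singleton]
  have e : ∀ a b c : ℤ, castPt ![a, b, c] = ![(a:ℝ), (b:ℝ), (c:ℝ)] := by
    intro a b c
    funext i
    fin_cases i <;> rfl
  rw [e, e, e, e]
  norm_num

/-- the open simplex -/
def openMax : Set (Fin 3 → ℝ) :=
  {x | 0 < x 2 + 1 ∧ 8 * (x 2 + 1) < 9 * (x 0 + 1) ∧ 8 * (x 2 + 1) < 9 * (x 1 + 1) ∧
    3 * (x 0 + x 1 + 1) < 5 * (x 2 + 1)}

/-- the closed simplex -/
def closedMax : Set (Fin 3 → ℝ) :=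
  {x | 0 ≤ x 2 + 1 ∧ 8 * (x 2 + 1) ≤ 9 * (x 0 + 1) ∧ 8 * (x 2 + 1) ≤ 9 * (x 1 + 1) ∧
    3 * (x 0 + x 1 + 1) ≤ 5 * (x 2 + 1)}

theorem closedMax_sub : closedMax ⊆ Pmax := by
  rintro x ⟨h1, h2, h3, h4⟩
  have hc : Convex ℝ Pmax := convex_convexHull ℝ _
  have hm : ∀ i, (![![-1,-1,-1], ![0,-1,-1], ![-1,0,-1], ![7,7,8]] : Fin 4 → Fin 3 → ℝ) i ∈ Pmax := by
    intro i
    apply subset_convexHull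
    fin_cases i <;> simp
  have := hc.sum_mem (t := Finset.univ)
    (w := ![(5 * (x 2 + 1) - 3 * (x 0 + x 1 + 1)) / 3, (9 * (x 0 + 1) - 8 * (x 2 + 1)) / 9,
      (9 * (x 1 + 1) - 8 * (x 2 + 1)) / 9, (x 2 + 1) / 9])
    (z := ![![-1,-1,-1], ![0,-1,-1], ![-1,0,-1], ![7,7,8]])
    (by
      intro i _
      fin_cases i
      · exact div_nonneg (by linarith) (by norm_num)
      · exact div_nonneg (by linarith) (by norm_num)
      · exact div_nonneg (by linarith) (by norm_num)
      · exact div_nonneg (by linarith) (by norm_num))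
    (by
      simp only [Fin.sum_univ_four, Matrix.cons_val]
      ring)
    (fun i _ => hm i)
  convert this using 1
  funext j
  fin_cases j <;> simp [Fin.sum_univ_four] <;> ring

theorem openMax_sub : openMax ⊆ interior Pmax := by
  apply interior_maximal
  · exact fun x h => closedMax_sub ⟨h.1.le, h.2.1.le, h.2.2.1.le, h.2.2.2.le⟩
  · unfold openMax
    simp only [Set.ofPred_and]
    refine IsOpen.inter ?_ (IsOpen.inter ?_ (IsOpen.inter ?_ ?_)) <;>
      exact isOpen_lt (by fun_prop) (by fun_prop)

theorem Pmax_sub : Pmax ⊆ closedMax := by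
  apply convexHull_min
  · intro x hx
    simp only [Set.mem_insert_iff, Set.mem_singleton_iff] at hx
    rcases hx with rfl | rfl | rfl | rfl <;> simp [closedMax] <;> norm_num
  · rintro x ⟨a1, a2, a3, a4⟩ y ⟨b1, b2, b3, b4⟩ s t hs ht hst
    obtain rfl : t = 1 - s := by linarith
    simp only [closedMax, Set.mem_ofPred_eq, Pi.add_apply, Pi.smul_apply, smul_eq_mul]
    refine ⟨?_, ?_, ?_, ?_⟩ <;> nlinarith

/-- Interior points satisfy strict inequalities. -/
theorem interior_strict (x : Fin 3 → ℝ) (hx : x ∈ interior Pmax) : x ∈ openMax := by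
  -- move slightly away from a point beyond each facet
  have hmem : ∀ d : Fin 3 → ℝ, ∃ ε : ℝ, 0 < ε ∧ x + ε • d ∈ closedMax := by
    intro d
    have hcont : Filter.Tendsto (fun ε : ℝ => x + ε • d) (nhds 0) (nhds x) := by
      have : Continuous (fun ε : ℝ => x + ε • d) := by fun_prop
      simpa using this.tendsto 0
    have := hcont.eventually (mem_interior_iff_mem_nhds.1 hx)
    have h2 := (this.filter_mono (nhdsWithin_le_nhds (s := Set.Ioi 0))).and self_mem_nhdsWithin
    obtain ⟨ε, h, h'⟩ := h2.exists
    exact ⟨ε, h', Pmax_sub h⟩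
  refine ⟨?_, ?_, ?_, ?_⟩
  · obtain ⟨ε, h, h1, -⟩ := hmem ![0, 0, -1]
    simp at h1
    linarith
  · obtain ⟨ε, h, -, h1, -⟩ := hmem ![-1, 0, 0]
    simp at h1
    linarith
  · obtain ⟨ε, h, -, -, h1, -⟩ := hmem ![0, -1, 0]
    simp at h1
    linarith
  · obtain ⟨ε, h, -, -, -, h1⟩ := hmem ![1, 0, 0]
    simp at h1
    linarith

theorem Pmax_int : intLatPts Pmax = {0, ![1, 1, 1]} := by
  ext x
  simp only [intLatPts, Set.mem_ofPred_eq, Set.mem_insert_iff, Set.mem_singleton_iff]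
  constructor
  · intro h
    obtain ⟨h1, h2, h3, h4⟩ := interior_strict _ h
    simp only [castPt] at h1 h2 h3 h4
    norm_cast at h1 h2 h3 h4
    have h5 : (x 0 = 0 ∧ x 1 = 0 ∧ x 2 = 0) ∨ (x 0 = 1 ∧ x 1 = 1 ∧ x 2 = 1) := by
      have : x 2 ≤ 8 := by linarith
      have : 0 ≤ x 2 := by linarith
      generalize x 2 = c at *
      interval_cases c <;> omega
    rcases h5 with ⟨a, b, c⟩ | ⟨a, b, c⟩
    · left
      funext i
      fin_cases i <;> assumption
    · right
      funext i
      fin_cases i <;> assumption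
  · rintro (rfl | rfl) <;> apply openMax_sub <;> simp [openMax, castPt] <;> norm_num

theorem Pmax_dual : dualPolytope Pmax = {y : Fin 3 → ℝ |
    (fun i => (![2/3, 1/9, 1/9] : Fin 3 → ℝ) i * (1 - ∑ j, y j *
      (![![-1,-1,-1], ![0,-1,-1], ![-1,0,-1]] : Fin 3 → Fin 3 → ℝ) i j)) ∈ bodySimplex} := by
  ext y
  simp only [dualPolytope, bodySimplex, Set.mem_ofPred_eq, Fin.sum_univ_three, Matrix.cons_val]
  constructor
  · intro h
    have hm : ∀ i, (![![-1,-1,-1], ![0,-1,-1], ![-1,0,-1], ![7,7,8]] : Fin 4 → Fin 3 → ℝ) i ∈ Pmax := by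
      intro i
      apply subset_convexHull
      fin_cases i <;> simp
    have a0 := h _ (hm 0)
    have a1 := h _ (hm 1)
    have a2 := h _ (hm 2)
    have a3 := h _ (hm 3)
    simp only [Matrix.cons_val] at a0 a1 a2 a3
    refine ⟨?_, ?_, ?_, ?_⟩ <;> linarith
  · rintro ⟨a0, a1, a2, a3⟩
    have : Pmax ⊆ {x | y 0 * x 0 + y 1 * x 1 + y 2 * x 2 ≤ 1} := by
      apply convexHull_min
      · intro x hx
        simp only [Set.mem_insert_iff, Set.mem_singleton_iff] at hx
        rcases hx with rfl | rfl | rfl | rfl <;>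
          simp only [Set.mem_ofPred_eq, Matrix.cons_val] <;> linarith
      · intro x hx z hz s t hs ht hst
        obtain rfl : t = 1 - s := by linarith
        simp only [Set.mem_ofPred_eq, Pi.add_apply, Pi.smul_apply, smul_eq_mul] at *
        nlinarith
    intro x hx
    exact this hx

theorem Pmax_vol : 6 * (volume (dualPolytope Pmax)).toReal = 243 / 2 := by
  have hdet : (Matrix.of (![![-1,-1,-1], ![0,-1,-1], ![-1,0,-1]] : Fin 3 → Fin 3 → ℝ)).det = -1 := by
    simp [Matrix.det_fin_three]
  rw [Pmax_dual, vol_preimage _ _ _ (by rw [hdet]; norm_num), hdet, vol_simplex]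
  · simp only [Matrix.cons_val]
    rw [← ENNReal.ofReal_mul (by norm_num), ENNReal.toReal_ofReal (by norm_num)]
    norm_num
  · intro i
    fin_cases i <;> simp

/-- Among three-dimensional lattice polytopes with exactly two interior lattice points, one
of which is the origin, the normalised volume of the dual polytope is at most `243/2`, and
this maximum is attained by `conv{(−1,−1,−1),(0,−1,−1),(−1,0,−1),(7,7,8)}`. -/
theorem dual_volume_bound_two_point_three_polytopes :
    (∀ P : Set (Fin 3 → ℝ), IsKPoint3Polytope 2 P → (0 : Fin 3 → ℤ) ∈ intLatPts P →
      6 * (volume (dualPolytope P)).toReal ≤ 243 / 2) ∧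
    IsKPoint3Polytope 2 Pmax ∧ (0 : Fin 3 → ℤ) ∈ intLatPts Pmax ∧
    6 * (volume (dualPolytope Pmax)).toReal = 243 / 2 := by
  refine ⟨?_, ⟨⟨Vmax, ?_, Pmax_eq⟩, ?_, ?_⟩, ?_, Pmax_vol⟩
  · rintro P ⟨⟨V, -, rfl⟩, -, hcard⟩ hz
    have hz' : (0 : Fin 3 → ℝ) ∈ interior (hull V) := by
      have e : castPt (0 : Fin 3 → ℤ) = 0 := by funext j; simp [castPt]
      have := hz
      simp only [intLatPts, Set.mem_ofPred_eq, e] at this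
      exact this
    refine main_bound (V := V) hz' ?_
    intro p hp q hq hp0 hq0
    obtain ⟨a, b, hab, hI⟩ := Set.ncard_eq_two.1 hcard
    change p ∈ intLatPts (convexHull ℝ (castPt '' (V : Set (Fin 3 → ℤ)))) at hp
    change q ∈ intLatPts (convexHull ℝ (castPt '' (V : Set (Fin 3 → ℤ)))) at hq
    rw [hI] at hp hq hz
    simp only [Set.mem_insert_iff, Set.mem_singleton_iff] at hp hq hz
    grind
  · exact ⟨_, Finset.mem_insert_self _ _⟩
  · have h : (0 : Fin 3 → ℤ) ∈ intLatPts Pmax := by rw [Pmax_int]; simp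
    have h' : (interior (convexHull ℝ Pmax)).Nonempty := by
      refine ⟨castPt 0, ?_⟩
      have hc : Convex ℝ Pmax := convex_convexHull ℝ _
      rw [hc.convexHull_eq]
      exact h
    exact (interior_convexHull_nonempty_iff_affineSpan_eq_top).1 h'
  · rw [Pmax_int]
    apply Set.ncard_pair
    intro h
    have := congrFun h 0
    simp at this
  · rw [Pmax_int]; simp
end
end

section
/- Let S = conv{v₀, v₁, v₂} be a lattice triangle in ℤ² with exactly two interior lattice points, and translate one of the two interior lattice points to the origin. Then the normalized weight vector of S (the (λ₀,λ₁,λ₂) ∈ ℤ³_{>0} with λ₀v₀ + λ₁v₁ + λ₂v₂ = 0, gcd(λ₀,λ₁,λ₂) = 1, λ₀ ≤ λ₁ ≤ λ₂) is one of the eight vectors (1,1,1), (1,1,3), (1,2,2), (1,1,4), (1,2,3), (1,3,4), (1,4,5), (2,3,5); moreover each of these eight vectors occurs for some such triangle and choice of interior point. -/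
open Set MeasureTheory

noncomputable section

/-- The eight possible normalised weight vectors of a lattice triangle with two interior
lattice points. -/
def W22 : Set (ℤ × ℤ × ℤ) :=
  {(1,1,1), (1,1,3), (1,2,2), (1,1,4), (1,2,3), (1,3,4), (1,4,5), (2,3,5)}

/-- `lam` is the normalised weight vector of the lattice triangle with vertices `v 0, v 1,
v 2`, containing the origin in its interior: the `lam i` are positive, sum the vertices to
zero, have gcd one and are sorted increasingly. -/
def IsNormalisedWeight2 (v : Fin 3 → Fin 2 → ℤ) (lam : Fin 3 → ℤ) : Prop :=
  (∀ i, 0 < lam i) ∧ (∑ i, lam i • v i) = 0 ∧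
    Finset.univ.gcd lam = 1 ∧ Monotone lam

/-- `S = conv{v 0, v 1, v 2}` is a lattice triangle with exactly two interior lattice
points, one of which is the origin. -/
def IsTwoPointTriangleAtOrigin (v : Fin 3 → Fin 2 → ℤ) : Prop :=
  AffineIndependent ℝ (fun i => castPt (v i)) ∧
    (intLatPts (convexHull ℝ (Set.range fun i => castPt (v i)))).ncard = 2 ∧
    (0 : Fin 2 → ℤ) ∈ intLatPts (convexHull ℝ (Set.range fun i => castPt (v i)))


/-- Barycentric coordinates describe the interior lattice points of a lattice triangle. -/
lemma exists_bary (v : Fin 3 → Fin 2 → ℤ)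
    (hv : AffineIndependent ℝ (fun i => castPt (v i))) :
    ∃ β : (Fin 2 → ℤ) → Fin 3 → ℝ,
      (∀ x, x ∈ intLatPts (convexHull ℝ (Set.range fun i => castPt (v i))) ↔ ∀ i, 0 < β x i) ∧
      (∀ x, ∑ i, β x i = 1 ∧ ∀ j, ∑ i, β x i * (v i j : ℝ) = x j) ∧
      (∀ x w, ∑ i, w i = 1 → (∀ j, ∑ i, w i * (v i j : ℝ) = x j) → β x = w) := by
  have htop : affineSpan ℝ (Set.range fun i => castPt (v i)) = ⊤ := by
    rw [hv.affineSpan_eq_top_iff_card_eq_finrank_add_one]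
    simp
  let b : AffineBasis (Fin 3) ℝ (Fin 2 → ℝ) := ⟨fun i => castPt (v i), hv, htop⟩
  have hb : ∀ i, b i = castPt (v i) := fun i => rfl
  refine ⟨fun x i => b.coord i (castPt x), ?_, ?_, ?_⟩
  · intro x
    have := b.interior_convexHull
    have h2 : (Set.range fun i => castPt (v i)) = Set.range b := rfl
    rw [h2]
    unfold intLatPts
    rw [this]
    rfl
  · intro x
    refine ⟨b.sum_coord_apply_eq_one _, fun j => ?_⟩
    have := congrFun (b.linear_combination_coord_eq_self (castPt x)) j
    simpa [hb, castPt] using this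
  · intro x w hw hx
    have h1 : castPt x = Finset.univ.affineCombination ℝ b w := by
      rw [Finset.affineCombination_eq_linear_combination _ _ _ hw]
      funext j
      simp [hb, castPt, ← hx j]
    funext i
    show b.coord i (castPt x) = w i
    rw [h1]
    exact b.coord_apply_combination_of_mem (Finset.mem_univ i) hw

/-- Count of the multipliers `k` that kill the residue of `l` modulo `h`. -/
lemma card_bad (h l : ℕ) (hh : 0 < h) :
    ((Finset.Ioo 0 h).filter (fun k => h ∣ k * l)).card ≤ Nat.gcd h l - 1 := by
  obtain ⟨g, hg⟩ : ∃ g, g = Nat.gcd h l := ⟨_, rfl⟩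
  have hgpos : 0 < g := hg ▸ Nat.gcd_pos_of_pos_left _ hh
  obtain ⟨m, hm⟩ : g ∣ h := hg ▸ Nat.gcd_dvd_left _ _
  obtain ⟨n, hn⟩ : g ∣ l := hg ▸ Nat.gcd_dvd_right _ _
  have hcop : Nat.Coprime m n := by
    have : g * Nat.gcd m n = g * 1 := by
      rw [← Nat.gcd_mul_left, ← hm, ← hn, ← hg, mul_one]
    exact Nat.eq_of_mul_eq_mul_left hgpos this
  have hmpos : 0 < m := by
    rcases Nat.eq_zero_or_pos m with h0 | h0
    · subst h0; omega
    · exact h0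
  have hd : ∀ k, h ∣ k * l → m ∣ k := by
    intro k hk
    rw [hm, hn, show k * (g * n) = g * (k * n) by ring] at hk
    exact hcop.dvd_of_dvd_mul_right (Nat.dvd_of_mul_dvd_mul_left hgpos hk)
  rw [← hg]
  have hc : (Finset.Ioo 0 g).card = g - 1 := by simp
  rw [← hc]
  apply Finset.card_le_card_of_injOn (fun k => k / m)
  · intro k hk
    simp only [Finset.coe_filter, Finset.mem_Ioo, Set.mem_ofPred_eq] at hk
    obtain ⟨t, rfl⟩ := hd k hk.2
    simp only [Finset.coe_Ioo, Set.mem_Ioo]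
    rw [Nat.mul_div_cancel_left _ hmpos]
    obtain ⟨⟨h1, h2⟩, _⟩ := hk
    refine ⟨Nat.pos_of_ne_zero (by rintro rfl; simp at h1), ?_⟩
    rw [hm, mul_comm g m] at h2
    exact lt_of_mul_lt_mul_left h2 (Nat.zero_le _)
  · intro k hk k' hk' he
    simp only [Finset.coe_filter, Finset.mem_Ioo, Set.mem_ofPred_eq] at hk hk'
    obtain ⟨t, rfl⟩ := hd k hk.2
    obtain ⟨t', rfl⟩ := hd k' hk'.2
    simp only [Nat.mul_div_cancel_left _ hmpos] at he
    rw [he]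

/-- The arithmetic of weights satisfying the counting inequality. -/
lemma arith_weights (a b c : ℕ) (ha : 0 < a) (hab : a ≤ b) (hbc : b ≤ c)
    (hg : Nat.gcd a (Nat.gcd b c) = 1)
    (hin : a + b + c ≤ Nat.gcd (a + b + c) a + Nat.gcd (a + b + c) b
      + Nat.gcd (a + b + c) c + 2) :
    ((a : ℤ), (b : ℤ), (c : ℤ)) ∈ W22 ∨ (a = 1 ∧ b = 1 ∧ c = 2) := by
  have key : ∀ l h : ℕ, 0 < l → l ≤ Nat.gcd h l + 2 → l ≤ 4 ∨ l ∣ h := by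
    intro l h hl hle
    by_cases hd : l ∣ h
    · exact Or.inr hd
    left
    obtain ⟨m, hm⟩ : Nat.gcd h l ∣ l := Nat.gcd_dvd_right _ _
    have h1 : m ≠ 1 := by
      rintro rfl
      apply hd
      rw [mul_one] at hm
      rw [hm]
      exact Nat.gcd_dvd_left _ _
    have h0 : m ≠ 0 := by rintro rfl; omega
    have : Nat.gcd h l * 2 ≤ Nat.gcd h l * m := Nat.mul_le_mul_left _ (by omega)
    omega
  have ga : Nat.gcd (a + b + c) a ≤ a := Nat.gcd_le_right _ ha
  have gb : Nat.gcd (a + b + c) b ≤ b := Nat.gcd_le_right _ (by omega)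
  have gc : Nat.gcd (a + b + c) c ≤ c := Nat.gcd_le_right _ (by omega)
  have kb := key b (a + b + c) (by omega) (by omega)
  have kc := key c (a + b + c) (by omega) (by omega)
  have fin : a ≤ 4 → b ≤ 4 → c ≤ 8 →
      ((a : ℤ), (b : ℤ), (c : ℤ)) ∈ W22 ∨ (a = 1 ∧ b = 1 ∧ c = 2) := by
    intro h1 h2 h3
    clear kb kc key ga gb gc
    unfold W22
    interval_cases a <;> interval_cases b <;> interval_cases c <;> simp at hg hin ⊢
  rcases kc with kc | kc
  · exact fin (by omega) (by omega) (by omega)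
  have kc' : c ∣ a + b := (Nat.dvd_add_left (dvd_refl c)).1 kc
  obtain ⟨m, hm⟩ := kc'
  have hm2 : m = 1 ∨ m = 2 := by
    have h0 : m ≠ 0 := by rintro rfl; omega
    have h3 : m < 3 := by
      by_contra hcon
      have : c * 3 ≤ c * m := Nat.mul_le_mul_left _ (by omega)
      omega
    omega
  rcases hm2 with rfl | rfl
  · rcases kb with kb | kb
    · exact fin (by omega) (by omega) (by omega)
    have hb2 : b ∣ 2 * a := by
      have : a + b + c = 2 * a + b * 2 := by omega
      rw [this] at kb
      exact (Nat.dvd_add_left (Dvd.intro _ rfl)).1 kb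
    obtain ⟨n, hn⟩ := hb2
    have hn2 : n = 1 ∨ n = 2 := by
      have h0 : n ≠ 0 := by rintro rfl; omega
      have h3 : n < 3 := by
        by_contra hcon
        have : b * 3 ≤ b * n := Nat.mul_le_mul_left _ (by omega)
        omega
      omega
    have ha1 : a = 1 := by
      have : a ∣ Nat.gcd a (Nat.gcd b c) := by
        refine Nat.dvd_gcd dvd_rfl (Nat.dvd_gcd ?_ ?_)
        · rcases hn2 with rfl | rfl
          · exact ⟨2, by omega⟩
          · exact ⟨1, by omega⟩
        · rcases hn2 with rfl | rfl
          · exact ⟨3, by omega⟩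
          · exact ⟨2, by omega⟩
      rw [hg] at this
      exact Nat.dvd_one.1 this
    rcases hn2 with rfl | rfl
    · exact fin (by omega) (by omega) (by omega)
    · exact fin (by omega) (by omega) (by omega)
  · have ha1 : a = 1 := by
      have : a ∣ Nat.gcd a (Nat.gcd b c) :=
        Nat.dvd_gcd dvd_rfl (Nat.dvd_gcd ⟨1, by omega⟩ ⟨1, by omega⟩)
      rw [hg] at this
      exact Nat.dvd_one.1 this
    exact fin (by omega) (by omega) (by omega)

/-- A triangle of positive determinant: its interior lattice points via determinants. -/
lemma concrete (a₁ a₂ b₁ b₂ c₁ c₂ : ℤ) (p : Fin 2 → ℤ)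
    (hD : 0 < (b₁ - a₁) * (c₂ - a₂) - (b₂ - a₂) * (c₁ - a₁)) (hp : p ≠ 0)
    (hx : ∀ x : Fin 2 → ℤ,
      (0 < (b₁ * c₂ - b₂ * c₁) - x 0 * (c₂ - b₂) + x 1 * (c₁ - b₁) ∧
       0 < (x 0 - a₁) * (c₂ - a₂) - (x 1 - a₂) * (c₁ - a₁) ∧
       0 < (b₁ - a₁) * (x 1 - a₂) - (b₂ - a₂) * (x 0 - a₁)) ↔
      ((x 0 = 0 ∧ x 1 = 0) ∨ (x 0 = p 0 ∧ x 1 = p 1))) :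
    IsTwoPointTriangleAtOrigin ![![a₁, a₂], ![b₁, b₂], ![c₁, c₂]] := by
  have hDR : (0 : ℝ) < (b₁ - a₁) * (c₂ - a₂) - (b₂ - a₂) * (c₁ - a₁) := by exact_mod_cast hD
  have hv : AffineIndependent ℝ
      (fun i => castPt ((![![a₁, a₂], ![b₁, b₂], ![c₁, c₂]] : Fin 3 → Fin 2 → ℤ) i)) := by
    rw [affineIndependent_iff_of_fintype]
    intro w hw hs
    rw [Finset.weightedVSub_eq_linear_combination _ hw] at hs
    have e0 := congrFun hs 0
    have e1 := congrFun hs 1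
    simp [Fin.sum_univ_three, castPt] at hw e0 e1
    have w1 : w 1 * (((b₁ : ℝ) - a₁) * (c₂ - a₂) - (b₂ - a₂) * (c₁ - a₁)) = 0 := by
      linear_combination (c₂ - a₂ : ℝ) * (e0 - a₁ * hw) - (c₁ - a₁ : ℝ) * (e1 - a₂ * hw)
    have w2 : w 2 * (((b₁ : ℝ) - a₁) * (c₂ - a₂) - (b₂ - a₂) * (c₁ - a₁)) = 0 := by
      linear_combination -(b₂ - a₂ : ℝ) * (e0 - a₁ * hw) + (b₁ - a₁ : ℝ) * (e1 - a₂ * hw)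
    have w1' := (mul_eq_zero.1 w1).resolve_right hDR.ne'
    have w2' := (mul_eq_zero.1 w2).resolve_right hDR.ne'
    intro i
    fin_cases i
    · simpa [w1', w2'] using hw
    · exact w1'
    · exact w2'
  obtain ⟨β, h1, h2, h3⟩ := exists_bary _ hv
  have hset : intLatPts (convexHull ℝ (Set.range fun i =>
      castPt ((![![a₁, a₂], ![b₁, b₂], ![c₁, c₂]] : Fin 3 → Fin 2 → ℤ) i))) = {0, p} := by
    ext x
    have hw := h3 x ![
      (((b₁ * c₂ - b₂ * c₁) - x 0 * (c₂ - b₂) + x 1 * (c₁ - b₁) : ℤ) : ℝ) /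
        ((b₁ - a₁) * (c₂ - a₂) - (b₂ - a₂) * (c₁ - a₁)),
      (((x 0 - a₁) * (c₂ - a₂) - (x 1 - a₂) * (c₁ - a₁) : ℤ) : ℝ) /
        ((b₁ - a₁) * (c₂ - a₂) - (b₂ - a₂) * (c₁ - a₁)),
      (((b₁ - a₁) * (x 1 - a₂) - (b₂ - a₂) * (x 0 - a₁) : ℤ) : ℝ) /
        ((b₁ - a₁) * (c₂ - a₂) - (b₂ - a₂) * (c₁ - a₁))]
      (by
        simp only [Fin.sum_univ_three, Matrix.cons_val]
        rw [← add_div, ← add_div, div_eq_one_iff_eq hDR.ne']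
        push_cast; ring)
      (by
        intro j
        simp only [Fin.sum_univ_three, Matrix.cons_val]
        rw [div_mul_eq_mul_div, div_mul_eq_mul_div, div_mul_eq_mul_div, ← add_div, ← add_div,
          div_eq_iff hDR.ne']
        fin_cases j <;> simp <;> ring)
    rw [h1, hw, Fin.forall_fin_succ, Fin.forall_fin_two]
    have hxx := hx x
    simp only [Matrix.cons_val, Fin.succ_zero_eq_one, Fin.succ_one_eq_two]
    rw [div_pos_iff_of_pos_right hDR, div_pos_iff_of_pos_right hDR, div_pos_iff_of_pos_right hDR,
      Int.cast_pos, Int.cast_pos, Int.cast_pos, hxx]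
    simp [funext_iff, Fin.forall_fin_two]
  refine ⟨hv, ?_, ?_⟩
  · rw [hset, Set.ncard_pair hp.symm]
  · rw [hset]; simp

/-- The counting step: at most four multipliers `k` have all residues nonzero. -/
lemma card_good (v : Fin 3 → Fin 2 → ℤ) (L : Fin 3 → ℕ) (h : ℕ) (hh : h = ∑ i, L i)
    (hpos : 0 < h) (hg : ∀ n : ℕ, (∀ i, h ∣ n * L i) → h ∣ n)
    (hsum : ∀ j, ∑ i, (L i : ℤ) * v i j = 0)
    (β : (Fin 2 → ℤ) → Fin 3 → ℝ) (I : Set (Fin 2 → ℤ)) (hI : I.ncard = 2)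
    (h1 : ∀ x, x ∈ I ↔ ∀ i, 0 < β x i)
    (h3 : ∀ (x : Fin 2 → ℤ) w, ∑ i, w i = 1 → (∀ j, ∑ i, w i * (v i j : ℝ) = x j) → β x = w) :
    ((Finset.Ioo 0 h).filter (fun k => ∀ i, ¬ h ∣ k * L i)).card ≤ 4 := by
  classical
  obtain ⟨p₁, p₂, hp, hIp⟩ := Set.ncard_eq_two.1 hI
  have hR : (0 : ℝ) < h := by exact_mod_cast hpos
  have hRn : (h : ℝ) ≠ 0 := hR.ne'
  have hsumR : ∀ j, ∑ i, (L i : ℝ) * (v i j : ℝ) = 0 := fun j => by exact_mod_cast hsum j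
  -- real form of the division algorithm
  have hdiv : ∀ k i, (((k * L i % h : ℕ)) : ℝ) = k * L i - h * ((k * L i / h : ℕ) : ℝ) := by
    intro k i
    have := Nat.mod_add_div (k * L i) h
    have h' : (((k * L i % h + h * (k * L i / h) : ℕ)) : ℝ) = ((k * L i : ℕ) : ℝ) := by rw [this]
    push_cast at h'
    push_cast
    linarith
  have hmodsum : ∀ k, (∀ i, ¬ h ∣ k * L i) →
      ∑ i, (k * L i % h) = h ∨ ∑ i, (k * L i % h) = 2 * h := by
    intro k hk
    have hd : h ∣ ∑ i, (k * L i % h) := by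
      have e : ∑ i, (k * L i % h) + h * ∑ i, (k * L i / h) = h * k := by
        rw [Finset.mul_sum, ← Finset.sum_add_distrib]
        simp only [Nat.mod_add_div]
        rw [← Finset.mul_sum, ← hh, mul_comm]
      exact (Nat.dvd_add_left (Dvd.intro _ rfl)).1 (e ▸ Dvd.intro _ rfl)
    have hp' : ∀ i, 0 < k * L i % h := fun i =>
      Nat.pos_of_ne_zero fun hz => hk i (Nat.dvd_of_mod_eq_zero hz)
    have hl' : ∀ i, k * L i % h < h := fun i => Nat.mod_lt _ hpos
    obtain ⟨m, hm⟩ := hd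
    rw [Fin.sum_univ_three] at hm ⊢
    have p0 := hp' 0
    have l0 := hl' 0
    have l1 := hl' 1
    have l2 := hl' 2
    have hm0 : m ≠ 0 := by rintro rfl; omega
    have hm3 : m < 3 := by
      by_contra hcon
      have : h * 3 ≤ h * m := Nat.mul_le_mul_left _ (by omega)
      omega
    interval_cases m <;> omega
  let q : ℕ → Fin 2 → ℤ := fun k =>
    if ∑ i, (k * L i % h) = h then fun j => -∑ i, ((k * L i / h : ℕ) : ℤ) * v i j
    else fun j => ∑ i, (((k * L i / h : ℕ) : ℤ) + 1) * v i j
  have qA : ∀ k, ∑ i, (k * L i % h) = h → β (q k) = fun i => ((k * L i % h : ℕ) : ℝ) / h := by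
    intro k hs
    apply h3
    · rw [← Finset.sum_div, div_eq_one_iff_eq hRn]
      exact_mod_cast hs
    · intro j
      have hs' := hsumR j
      simp only [q, if_pos hs]
      simp only [Fin.sum_univ_three] at hs' ⊢
      rw [hdiv, hdiv, hdiv]
      simp only [Int.cast_neg, Int.cast_add, Int.cast_mul, Int.cast_natCast, Int.cast_one]
      field_simp
      linear_combination (k : ℝ) * hs'
  have qB : ∀ k, (∀ i, ¬ h ∣ k * L i) → ¬ ∑ i, (k * L i % h) = h →
      β (q k) = fun i => 1 - ((k * L i % h : ℕ) : ℝ) / h := by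
    intro k hk hs
    have h2 := (hmodsum k hk).resolve_left hs
    have h2R : ∑ i, (((k * L i % h : ℕ)) : ℝ) = 2 * h := by exact_mod_cast h2
    apply h3
    · rw [Finset.sum_sub_distrib, ← Finset.sum_div, h2R, mul_div_assoc, div_self hRn]
      norm_num
    · intro j
      have hs' := hsumR j
      simp only [q, if_neg hs]
      simp only [Fin.sum_univ_three] at hs' ⊢
      rw [hdiv, hdiv, hdiv]
      simp only [Int.cast_neg, Int.cast_add, Int.cast_mul, Int.cast_natCast, Int.cast_one]
      field_simp
      linear_combination -(k : ℝ) * hs'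
  have qI : ∀ k, (∀ i, ¬ h ∣ k * L i) → q k = p₁ ∨ q k = p₂ := by
    intro k hk
    have : q k ∈ I := by
      rw [h1]
      intro i
      have hp' : 0 < k * L i % h := 
        Nat.pos_of_ne_zero fun hz => hk i (Nat.dvd_of_mod_eq_zero hz)
      have hl' : k * L i % h < h := Nat.mod_lt _ hpos
      by_cases hs : ∑ i, (k * L i % h) = h
      · rw [qA k hs]
        have : (0 : ℝ) < ((k * L i % h : ℕ) : ℝ) := by exact_mod_cast hp'
        positivity
      · rw [qB k hk hs]
        have : ((k * L i % h : ℕ) : ℝ) < h := by exact_mod_cast hl'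
        have := (div_lt_one hR).2 this
        simp only [sub_pos]
        exact this
    rw [hIp] at this
    simpa using this
  have hfin : ∀ k k', k < h → k' < h → (∀ i, k * L i % h = k' * L i % h) → k = k' := by
    have aux : ∀ k k', k ≤ k' → k' < h → (∀ i, k * L i % h = k' * L i % h) → k = k' := by
      intro k k' hle hlt he
      have : h ∣ k' - k := by
        apply hg
        intro i
        rw [Nat.sub_mul]
        exact (Nat.modEq_iff_dvd' (Nat.mul_le_mul_right _ hle)).1 (he i)
      have := Nat.eq_zero_of_dvd_of_lt this (by omega)
      omega
    intro k k' hk hk' he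
    rcases le_total k k' with hle | hle
    · exact aux k k' hle hk' he
    · exact (aux k' k hle hk fun i => (he i).symm).symm
  have hcard : (Finset.univ : Finset (Bool × Bool)).card = 4 := by decide
  rw [← hcard]
  apply Finset.card_le_card_of_injOn
    (fun k => (decide (∑ i, (k * L i % h) = h), decide (q k = p₁)))
  · intro k _
    simp
  · intro k hk k' hk' he
    simp only [Finset.coe_filter, Finset.mem_Ioo, Set.mem_ofPred_eq] at hk hk'
    simp only [Prod.mk.injEq, decide_eq_decide] at he
    obtain ⟨he1, he2⟩ := he
    have hq : q k = q k' := by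
      rcases qI k hk.2 with ha | ha
      · rw [ha, he2.1 ha]
      · rcases qI k' hk'.2 with hb | hb
        · rw [hb, he2.2 hb]
        · rw [ha, hb]
    apply hfin k k' hk.1.2 hk'.1.2
    intro i
    by_cases hs : ∑ i, (k * L i % h) = h
    · have e1 := qA k hs
      rw [hq, qA k' (he1.1 hs)] at e1
      have := congrFun e1 i
      simp only [div_left_inj' hRn] at this
      exact_mod_cast this.symm
    · have e1 := qB k hk.2 hs
      rw [hq, qB k' hk'.2 (fun hc => hs (he1.2 hc))] at e1
      have := congrFun e1 i
      simp only [sub_right_inj, div_left_inj' hRn] at this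
      exact_mod_cast this.symm

/-- Weights `(1,1,2)` never belong to a triangle with exactly two interior points. -/
lemma not_112 (v : Fin 3 → Fin 2 → ℤ)
    (hsum : ∀ j, v 0 j + v 1 j + 2 * v 2 j = 0)
    (β : (Fin 2 → ℤ) → Fin 3 → ℝ) (I : Set (Fin 2 → ℤ)) (hI : I.ncard = 2)
    (h0 : (0 : Fin 2 → ℤ) ∈ I)
    (h1 : ∀ x, x ∈ I ↔ ∀ i, 0 < β x i)
    (h2 : ∀ x : Fin 2 → ℤ, ∑ i, β x i = 1 ∧ ∀ j, ∑ i, β x i * (v i j : ℝ) = x j)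
    (h3 : ∀ (x : Fin 2 → ℤ) w, ∑ i, w i = 1 → (∀ j, ∑ i, w i * (v i j : ℝ) = x j) → β x = w) :
    False := by
  obtain ⟨p, hp0, hIp⟩ : ∃ p, p ≠ 0 ∧ ∀ x, x ∈ I → x = 0 ∨ x = p := by
    obtain ⟨p₁, p₂, hp, rfl⟩ := Set.ncard_eq_two.1 hI
    rcases h0 with h0 | h0
    · exact ⟨p₂, by rw [h0]; exact hp.symm, fun x hx => by rw [h0]; simpa using hx⟩
    · have h0 : 0 = p₂ := h0
      exact ⟨p₁, by rw [h0]; exact hp, fun x hx => by rw [h0]; exact Or.symm (by simpa using hx)⟩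
  have hpI : p ∈ I := by
    by_contra hc
    have : I ⊆ {0} := fun x hx => by
      rcases hIp x hx with h | h
      · exact h
      · exact absurd (h ▸ hx) hc
    have := Set.ncard_le_ncard this
    rw [hI, Set.ncard_singleton] at this
    omega
  have hsumR : ∀ j, (v 0 j : ℝ) + v 1 j + 2 * v 2 j = 0 := fun j => by exact_mod_cast hsum j
  have hpos := (h1 p).1 hpI
  obtain ⟨s1, s2⟩ := h2 p
  simp only [Fin.sum_univ_three] at s1 s2 h3
  obtain ⟨x, hx⟩ : ∃ x, x = β p 0 := ⟨_, rfl⟩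
  obtain ⟨y, hy⟩ : ∃ y, y = β p 1 := ⟨_, rfl⟩
  obtain ⟨z, hz⟩ : ∃ z, z = β p 2 := ⟨_, rfl⟩
  have px := hpos 0
  have py := hpos 1
  have pz := hpos 2
  rw [← hx, ← hy, ← hz] at s1
  simp only [← hx, ← hy, ← hz] at s2
  rw [← hx] at px
  rw [← hy] at py
  rw [← hz] at pz
  have b0 : β 0 = ![1/4, 1/4, 1/2] := by
    apply h3
    · simp; norm_num
    · intro j
      have := hsumR j
      simp
      linarith
  -- any interior point has the coordinates of `0` or of `p`
  have main : ∀ (t : Fin 2 → ℤ) (a b c : ℝ), 0 < a → 0 < b → 0 < c → a + b + c = 1 →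
      (∀ j, a * (v 0 j : ℝ) + b * v 1 j + c * v 2 j = t j) →
      (a = 1/4 ∧ b = 1/4 ∧ c = 1/2) ∨ (a = x ∧ b = y ∧ c = z) := by
    intro t a b c ha hb hc hs ht
    have e := h3 t ![a, b, c] (by simpa using hs) (by simpa using ht)
    have hm : t ∈ I := by
      rw [h1, e]
      intro i
      fin_cases i
      · exact ha
      · exact hb
      · exact hc
    rcases hIp t hm with h | h
    · left
      rw [h, b0] at e
      have e0 := congrFun e 0
      have e1 := congrFun e 1
      have e2 := congrFun e 2
      simp at e0 e1 e2
      refine ⟨?_, ?_, ?_⟩ <;> linarith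
    · right
      rw [h] at e
      rw [hx, hy, hz, e]
      simp
  rcases lt_trichotomy x (1/2) with c0 | c0 | c0
  · rcases lt_trichotomy y (1/2) with c1 | c1 | c1
    · rcases main (-p) (1/2 - x) (1/2 - y) (1 - z) (by linarith) (by linarith) (by linarith)
        (by linarith) (fun j => by
          have e1 := s2 j
          have e2 := hsumR j
          simp only [Pi.neg_apply, Int.cast_neg]
          linarith) with ⟨u1, u2, u3⟩ | ⟨u1, u2, u3⟩
      · apply hp0
        funext j
        have e1 := s2 j
        have e2 := hsumR j
        have hx' : x = 1/4 := by linarith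
        have hy' : y = 1/4 := by linarith
        have hz' : z = 1/2 := by linarith
        rw [hx', hy', hz'] at e1
        have : (p j : ℝ) = 0 := by linarith
        exact_mod_cast this
      · apply hp0
        funext j
        have e1 := s2 j
        have e2 := hsumR j
        have hx' : x = 1/4 := by linarith
        have hy' : y = 1/4 := by linarith
        have hz' : z = 1/2 := by linarith
        rw [hx', hy', hz'] at e1
        have : (p j : ℝ) = 0 := by linarith
        exact_mod_cast this
    · rcases main (fun j => -v 2 j - p j) (3/4 - x) (3/4 - y) (1/2 - z) (by linarith)
        (by linarith) (by linarith) (by linarith) (fun j => by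
          have e1 := s2 j
          have e2 := hsumR j
          push_cast
          linarith) with ⟨u1, u2, u3⟩ | ⟨u1, u2, u3⟩ <;> linarith
    · rcases main (fun j => p j - v 2 j - v 1 j) (x + 1/2) (y - 1/2) z (by linarith)
        (by linarith) (by linarith) (by linarith) (fun j => by
          have e1 := s2 j
          have e2 := hsumR j
          push_cast
          linarith) with ⟨u1, u2, u3⟩ | ⟨u1, u2, u3⟩ <;> linarith
  · rcases main (fun j => -v 2 j - p j) (3/4 - x) (3/4 - y) (1/2 - z) (by linarith)
      (by linarith) (by linarith) (by linarith) (fun j => by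
        have e1 := s2 j
        have e2 := hsumR j
        push_cast
        linarith) with ⟨u1, u2, u3⟩ | ⟨u1, u2, u3⟩ <;> linarith
  · rcases main (fun j => p j - v 2 j - v 0 j) (x - 1/2) (y + 1/2) z (by linarith)
      (by linarith) (by linarith) (by linarith) (fun j => by
        have e1 := s2 j
        have e2 := hsumR j
        push_cast
        linarith) with ⟨u1, u2, u3⟩ | ⟨u1, u2, u3⟩ <;> linarith

/-- The classification direction. -/
lemma weights_mem (v : Fin 3 → Fin 2 → ℤ) (lam : Fin 3 → ℤ) (hT : IsTwoPointTriangleAtOrigin v)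
    (hW : IsNormalisedWeight2 v lam) : (lam 0, lam 1, lam 2) ∈ W22 := by
  obtain ⟨hv, hI, h0⟩ := hT
  obtain ⟨hpos, hsum, hgcd, hmono⟩ := hW
  obtain ⟨β, h1, h2, h3⟩ := exists_bary v hv
  obtain ⟨L, hL⟩ : ∃ L : Fin 3 → ℕ, ∀ i, lam i = L i :=
    ⟨fun i => (lam i).toNat, fun i => (Int.toNat_of_nonneg (hpos i).le).symm⟩
  have hLpos : ∀ i, 0 < L i := fun i => by have := hpos i; rw [hL i] at this; exact_mod_cast this
  have hsumj : ∀ j, ∑ i, (L i : ℤ) * v i j = 0 := by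
    intro j
    have := congrFun hsum j
    simpa [hL] using this
  have hg1 : Nat.gcd (L 0) (Nat.gcd (L 1) (L 2)) = 1 := by
    have hd : ∀ i, ((Nat.gcd (L 0) (Nat.gcd (L 1) (L 2)) : ℕ) : ℤ) ∣ lam i := by
      intro i
      rw [hL i]
      apply Int.natCast_dvd_natCast.2
      fin_cases i
      · exact Nat.gcd_dvd_left _ _
      · exact (Nat.gcd_dvd_right _ _).trans (Nat.gcd_dvd_left _ _)
      · exact (Nat.gcd_dvd_right _ _).trans (Nat.gcd_dvd_right _ _)
    have := Finset.dvd_gcd (s := Finset.univ) (f := lam) (fun i _ => hd i)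
    rw [hgcd] at this
    exact Nat.dvd_one.1 (by exact_mod_cast this)
  have hab : L 0 ≤ L 1 := by
    have := hmono (show (0 : Fin 3) ≤ 1 by decide)
    rw [hL, hL] at this
    exact_mod_cast this
  have hbc : L 1 ≤ L 2 := by
    have := hmono (show (1 : Fin 3) ≤ 2 by decide)
    rw [hL, hL] at this
    exact_mod_cast this
  obtain ⟨h, hh⟩ : ∃ h, h = ∑ i, L i := ⟨_, rfl⟩
  have hh' : h = L 0 + L 1 + L 2 := by rw [hh, Fin.sum_univ_three]
  have p0 := hLpos 0
  have p1 := hLpos 1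
  have p2 := hLpos 2
  have hhpos : 0 < h := by omega
  have hgn : ∀ n : ℕ, (∀ i, h ∣ n * L i) → h ∣ n := by
    intro n hn
    have : h ∣ Nat.gcd (n * L 0) (Nat.gcd (n * L 1) (n * L 2)) :=
      Nat.dvd_gcd (hn 0) (Nat.dvd_gcd (hn 1) (hn 2))
    rwa [Nat.gcd_mul_left, Nat.gcd_mul_left, hg1, mul_one] at this
  have hc := card_good v L h hh hhpos hgn hsumj β _ hI h1 h3
  have hsub : Finset.Ioo 0 h ⊆ (Finset.Ioo 0 h).filter (fun k => ∀ i, ¬ h ∣ k * L i) ∪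
      ((Finset.Ioo 0 h).filter (fun k => h ∣ k * L 0) ∪
      ((Finset.Ioo 0 h).filter (fun k => h ∣ k * L 1) ∪
      (Finset.Ioo 0 h).filter (fun k => h ∣ k * L 2))) := by
    intro k hk
    simp only [Finset.mem_union, Finset.mem_filter, hk, true_and, Fin.forall_fin_succ]
    simp
    tauto
  have hle := (Finset.card_le_card hsub).trans (Finset.card_union_le _ _)
  have hle1 := Finset.card_union_le ((Finset.Ioo 0 h).filter (fun k => h ∣ k * L 0))
      ((Finset.Ioo 0 h).filter (fun k => h ∣ k * L 1) ∪
      (Finset.Ioo 0 h).filter (fun k => h ∣ k * L 2))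
  have hle2 := Finset.card_union_le ((Finset.Ioo 0 h).filter (fun k => h ∣ k * L 1))
      ((Finset.Ioo 0 h).filter (fun k => h ∣ k * L 2))
  have c0 := card_bad h (L 0) hhpos
  have c1 := card_bad h (L 1) hhpos
  have c2 := card_bad h (L 2) hhpos
  have g0 := Nat.gcd_pos_of_pos_left (L 0) hhpos
  have g1 := Nat.gcd_pos_of_pos_left (L 1) hhpos
  have g2 := Nat.gcd_pos_of_pos_left (L 2) hhpos
  rw [Nat.card_Ioo] at hle
  have hin : h ≤ Nat.gcd h (L 0) + Nat.gcd h (L 1) + Nat.gcd h (L 2) + 2 := by omega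
  rw [hh'] at hin
  rw [hL, hL, hL]
  rcases arith_weights (L 0) (L 1) (L 2) p0 hab hbc hg1 hin with hr | ⟨ra, rb, rc⟩
  · exact hr
  · exfalso
    refine not_112 v (fun j => ?_) β _ hI h0 h1 h2 h3
    have := hsumj j
    simpa [Fin.sum_univ_three, ra, rb, rc] using this

/-- Explicit weights are normalised. -/
lemma concrete_weight (a₁ a₂ b₁ b₂ c₁ c₂ l m n : ℤ) (hl : 0 < l) (hlm : l ≤ m) (hmn : m ≤ n)
    (hg : gcd l (gcd m n) = 1) (e1 : l * a₁ + m * b₁ + n * c₁ = 0)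
    (e2 : l * a₂ + m * b₂ + n * c₂ = 0) :
    IsNormalisedWeight2 ![![a₁, a₂], ![b₁, b₂], ![c₁, c₂]] ![l, m, n] := by
  refine ⟨?_, ?_, ?_, ?_⟩
  · intro i
    fin_cases i <;> simp <;> omega
  · funext j
    fin_cases j <;> simp [Fin.sum_univ_three, e1, e2]
  · have hu : (Finset.univ : Finset (Fin 3)) = {0, 1, 2} := by decide
    rw [hu]
    simp only [Finset.gcd_insert, Finset.gcd_singleton]
    simpa [Int.normalize_of_nonneg (show 0 ≤ n by omega)] using hg
  · intro i j hij
    fin_cases i <;> fin_cases j <;> simp at hij ⊢ <;> omega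

/-- The normalised weight vector of a lattice triangle with exactly two interior lattice
points (one translated to the origin) is one of the eight vectors `(1,1,1)`, `(1,1,3)`,
`(1,2,2)`, `(1,1,4)`, `(1,2,3)`, `(1,3,4)`, `(1,4,5)`, `(2,3,5)`, and each of these
eight vectors occurs for some such triangle. -/
theorem weights_of_two_point_triangles :
    (∀ (v : Fin 3 → Fin 2 → ℤ) (lam : Fin 3 → ℤ), IsTwoPointTriangleAtOrigin v →
      IsNormalisedWeight2 v lam → (lam 0, lam 1, lam 2) ∈ W22) ∧
    (∀ w ∈ W22, ∃ (v : Fin 3 → Fin 2 → ℤ) (lam : Fin 3 → ℤ),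
      IsTwoPointTriangleAtOrigin v ∧ IsNormalisedWeight2 v lam ∧
      (lam 0, lam 1, lam 2) = w) := by
  refine ⟨weights_mem, ?_⟩
  intro w hw
  simp only [W22, Set.mem_insert_iff, Set.mem_singleton_iff] at hw
  rcases hw with rfl | rfl | rfl | rfl | rfl | rfl | rfl | rfl
  · refine ⟨![![-2, -2], ![1, 0], ![1, 2]], ![1, 1, 1], concrete _ _ _ _ _ _ ![-1, -1]
      (by norm_num) (by simp [funext_iff]) (fun x => ?_), concrete_weight _ _ _ _ _ _ _ _ _
      (by norm_num) (by norm_num) (by norm_num) (by decide) (by norm_num) (by norm_num), rfl⟩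
    simp only [Matrix.cons_val]; omega
  · refine ⟨![![-2, -1], ![-1, -2], ![1, 1]], ![1, 1, 3], concrete _ _ _ _ _ _ ![-1, -1]
      (by norm_num) (by simp [funext_iff]) (fun x => ?_), concrete_weight _ _ _ _ _ _ _ _ _
      (by norm_num) (by norm_num) (by norm_num) (by decide) (by norm_num) (by norm_num), rfl⟩
    simp only [Matrix.cons_val]; omega
  · refine ⟨![![-2, -2], ![0, -1], ![1, 2]], ![1, 2, 2], concrete _ _ _ _ _ _ ![-1, -1]
      (by norm_num) (by simp [funext_iff]) (fun x => ?_), concrete_weight _ _ _ _ _ _ _ _ _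
      (by norm_num) (by norm_num) (by norm_num) (by decide) (by norm_num) (by norm_num), rfl⟩
    simp only [Matrix.cons_val]; omega
  · refine ⟨![![-2, 1], ![-2, -1], ![1, 0]], ![1, 1, 4], concrete _ _ _ _ _ _ ![-1, 0]
      (by norm_num) (by simp [funext_iff]) (fun x => ?_), concrete_weight _ _ _ _ _ _ _ _ _
      (by norm_num) (by norm_num) (by norm_num) (by decide) (by norm_num) (by norm_num), rfl⟩
    simp only [Matrix.cons_val]; omega
  · refine ⟨![![-3, -1], ![3, -1], ![-1, 1]], ![1, 2, 3], concrete _ _ _ _ _ _ ![-1, 0]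
      (by norm_num) (by simp [funext_iff]) (fun x => ?_), concrete_weight _ _ _ _ _ _ _ _ _
      (by norm_num) (by norm_num) (by norm_num) (by decide) (by norm_num) (by norm_num), rfl⟩
    simp only [Matrix.cons_val]; omega
  · refine ⟨![![-2, -1], ![2, -1], ![-1, 1]], ![1, 3, 4], concrete _ _ _ _ _ _ ![-1, 0]
      (by norm_num) (by simp [funext_iff]) (fun x => ?_), concrete_weight _ _ _ _ _ _ _ _ _
      (by norm_num) (by norm_num) (by norm_num) (by decide) (by norm_num) (by norm_num), rfl⟩
    simp only [Matrix.cons_val]; omega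
  · refine ⟨![![-3, -1], ![2, -1], ![-1, 1]], ![1, 4, 5], concrete _ _ _ _ _ _ ![-1, 0]
      (by norm_num) (by simp [funext_iff]) (fun x => ?_), concrete_weight _ _ _ _ _ _ _ _ _
      (by norm_num) (by norm_num) (by norm_num) (by decide) (by norm_num) (by norm_num), rfl⟩
    simp only [Matrix.cons_val]; omega
  · refine ⟨![![-3, -1], ![2, -1], ![0, 1]], ![2, 3, 5], concrete _ _ _ _ _ _ ![-1, 0]
      (by norm_num) (by simp [funext_iff]) (fun x => ?_), concrete_weight _ _ _ _ _ _ _ _ _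
      (by norm_num) (by norm_num) (by norm_num) (by decide) (by norm_num) (by norm_num), rfl⟩
    simp only [Matrix.cons_val]; omega
end
end

section
/- Let S be a three-dimensional lattice simplex (tetrahedron) in ℤ³ whose interior contains exactly the two lattice points o₁ and o₂. Then S can be written as S = conv(S₁ ∪ S₂), where S₁ and S₂ are (possibly lower-dimensional) lattice simplices whose vertices are lattice points of S, satisfying: (1) o₂ is a vertex of S₁ and o₁ is a vertex of S₂; (2) the relative interior of S₁ contains exactly the lattice point o₁ and the relative interior of S₂ contains exactly the lattice point o₂; (3) the number of common vertices of S₁ and S₂ equals dim S₁ + dim S₂ − 4. -/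
open Set MeasureTheory

noncomputable section

/-- A segment ending in a relative interior point can be prolonged. -/
lemma exists_lineMap_mem_of_intrinsicInterior {A : Set (Fin 3 → ℝ)} {x z : Fin 3 → ℝ}
    (hx : x ∈ intrinsicInterior ℝ A) (hz : z ∈ A) :
    ∃ t : ℝ, 1 < t ∧ AffineMap.lineMap z x t ∈ A := by
  obtain ⟨y, hy, rfl⟩ := mem_intrinsicInterior.1 hx
  have hz' : z ∈ affineSpan ℝ A := subset_affineSpan ℝ A hz
  let g : ℝ → affineSpan ℝ A := fun t =>
    ⟨AffineMap.lineMap z (y : Fin 3 → ℝ) t, AffineMap.lineMap_mem t hz' y.2⟩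
  have hg : Continuous g := by
    refine Continuous.subtype_mk ?_ _
    exact AffineMap.lineMap_continuous
  have hg1 : g 1 = y := by
    apply Subtype.ext
    simp [g]
  have hopen : IsOpen (g ⁻¹' interior ((↑) ⁻¹' A : Set (affineSpan ℝ A))) :=
    isOpen_interior.preimage hg
  obtain ⟨ε, hε, hb⟩ := Metric.isOpen_iff.1 hopen 1 (by simpa [hg1] using hy)
  have hmem : (1 + ε / 2) ∈ Metric.ball (1 : ℝ) ε := by
    rw [Metric.mem_ball, Real.dist_eq]
    rw [show (1 + ε / 2 - 1 : ℝ) = ε / 2 by ring, abs_of_pos (by positivity)]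
    linarith
  have h2 := interior_subset (hb hmem)
  exact ⟨1 + ε / 2, by linarith, h2⟩

/-- Vanishing of an affine function on a set extends to the affine span. -/
lemma affineMap_zero_of_mem_affineSpan {A : Set (Fin 3 → ℝ)} (g : (Fin 3 → ℝ) →ᵃ[ℝ] ℝ)
    (h : ∀ x ∈ A, g x = 0) {x : Fin 3 → ℝ} (hx : x ∈ affineSpan ℝ A) : g x = 0 := by
  refine affineSpan_induction (p := fun x => g x = 0) hx h ?_
  intro c u v w hu hv hw
  have hsub : g.linear (u -ᵥ v) = 0 := by
    rw [AffineMap.linearMap_vsub]; simp [hu, hv]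
  rw [AffineMap.map_vadd, map_smul, hsub, hw]; simp

lemma coord_lineMap (B : AffineBasis (Fin 4) ℝ (Fin 3 → ℝ)) (i : Fin 4) (z x : Fin 3 → ℝ) (t : ℝ) :
    B.coord i (AffineMap.lineMap z x t) = (1 - t) * B.coord i z + t * B.coord i x := by
  rw [AffineMap.apply_lineMap, AffineMap.lineMap_apply_module]; simp

/-- The half of the decomposition: the cone from `q` over the face hit by the ray from `q`
through `p`. -/
lemma half_decomposition (B : AffineBasis (Fin 4) ℝ (Fin 3 → ℝ)) (p q : Fin 3 → ℝ)
    (hp : ∀ i, 0 < B.coord i p) (hq : ∀ i, 0 < B.coord i q) (hpq : p ≠ q) :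
    ∃ F : Finset (Fin 4), (∀ i, i ∉ F → B.coord i p < B.coord i q) ∧
      q ∉ affineSpan ℝ (B '' F) ∧
      p ∈ intrinsicInterior ℝ (convexHull ℝ (insert q (B '' F))) ∧
      q ∉ intrinsicInterior ℝ (convexHull ℝ (insert q (B '' F))) ∧
      ∀ x ∈ intrinsicInterior ℝ (convexHull ℝ (insert q (B '' F))), ∀ i, 0 < B.coord i x := by
  classical
  set a : Fin 4 → ℝ := fun i => B.coord i p with ha
  set b : Fin 4 → ℝ := fun i => B.coord i q with hb
  obtain ⟨k, hk⟩ : ∃ k, ∀ i, a k / b k ≤ a i / b i := Finite.exists_min _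
  have hk' : ∀ i, a k * b i ≤ a i * b k := fun i => by
    have := hk i
    rwa [div_le_div_iff₀ (hq k) (hq i)] at this
  have hsa : ∑ i, a i = 1 := B.sum_coord_apply_eq_one p
  have hsb : ∑ i, b i = 1 := B.sum_coord_apply_eq_one q
  have hkk : a k < b k := by
    by_contra hcon
    push Not at hcon
    have hle : ∀ i, b i ≤ a i := fun i => by
      have h1 := hk' i
      have h2 : 0 < b k := hq k
      have h3 : 0 < b i := hq i
      have : b k * b i ≤ b k * a i := by nlinarith
      exact le_of_mul_le_mul_left this h2
    have heq : ∀ i ∈ Finset.univ, b i = a i :=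
      (Finset.sum_eq_sum_iff_of_le (fun i _ => hle i)).1 (by rw [hsa, hsb])
    apply hpq
    rw [← B.linear_combination_coord_eq_self p, ← B.linear_combination_coord_eq_self q]
    refine Finset.sum_congr rfl fun i hi => ?_
    have := heq i hi
    simp only [ha, hb] at this
    rw [this]
  let F : Finset (Fin 4) := Finset.univ.filter fun i => a k * b i < a i * b k
  have hF : ∀ i, i ∈ F ↔ a k * b i < a i * b k := fun i => by simp [F]
  have hnF : ∀ i, i ∉ F → a i * b k = a k * b i := fun i hi => by
    rw [hF, not_lt] at hi
    exact le_antisymm hi (hk' i)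
  have hkF : k ∉ F := by rw [hF]; simp
  have hcoord0 : ∀ i, i ∉ F → ∀ x ∈ B '' (F : Set (Fin 4)), B.coord i x = 0 := by
    rintro i hi _ ⟨j, hj, rfl⟩
    apply B.coord_apply_ne
    rintro rfl
    exact hi hj
  have hbk : 0 < b k := hq k
  set A := convexHull ℝ (insert q (B '' (F : Set (Fin 4)))) with hA
  have hqA : q ∈ A := subset_convexHull ℝ _ (mem_insert _ _)
  have hAnonneg : ∀ x ∈ A, ∀ i, 0 ≤ B.coord i x := by
    intro x hx i
    have hsub : A ⊆ convexHull ℝ (range B) := by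
      refine convexHull_min ?_ (convex_convexHull ℝ _)
      rintro y (rfl | ⟨j, hj, rfl⟩)
      · rw [B.convexHull_eq_nonneg_coord]
        exact fun i => (hq i).le
      · exact subset_convexHull ℝ _ (mem_range_self j)
    have := hsub hx
    rw [B.convexHull_eq_nonneg_coord] at this
    exact this i
  have hAk : ∀ x ∈ A, B.coord k x ≤ b k := by
    have hconv : Convex ℝ {x | B.coord k x ≤ b k} :=
      (convex_Iic (b k)).affine_preimage (B.coord k)
    have hsub : A ⊆ {x | B.coord k x ≤ b k} := by
      refine convexHull_min ?_ hconv
      rintro y (hy | hy)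
      · change B.coord k y ≤ b k
        rw [hy]
      · change B.coord k y ≤ b k
        rw [hcoord0 k hkF y hy]; exact hbk.le
    exact fun x hx => hsub hx
  -- membership criterion
  have hcrit : ∀ x, (∀ i, i ∉ F → B.coord i x * b k = B.coord k x * b i) →
      0 < B.coord k x → (∀ i ∈ F, B.coord k x * b i < B.coord i x * b k) → x ∈ A := by
    intro x h1 h2 h3
    set l := B.coord k x / b k with hl
    have hl0 : 0 < l := div_pos h2 hbk
    have hlk : l * b k = B.coord k x := div_mul_cancel₀ _ hbk.ne'
    let w : Option (Fin 4) → ℝ := fun o => o.elim l (fun i => B.coord i x - l * b i)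
    let z : Option (Fin 4) → (Fin 3 → ℝ) := fun o => o.elim q (fun i => if i ∈ F then B i else q)
    have hw0 : ∀ i, i ∉ F → B.coord i x - l * b i = 0 := by
      intro i hi
      have := h1 i hi
      have h4 : (B.coord i x - l * b i) * b k = 0 := by
        rw [← hlk] at this; linear_combination this
      exact (mul_eq_zero.1 h4).resolve_right hbk.ne'
    have hwpos : ∀ i, 0 ≤ B.coord i x - l * b i := by
      intro i
      by_cases hi : i ∈ F
      · have := h3 i hi
        rw [← hlk] at this
        have h4 : 0 < (B.coord i x - l * b i) * b k := by nlinarith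
        exact (pos_of_mul_pos_left h4 hbk.le).le
      · exact (hw0 i hi).ge
    have hmem := (convex_convexHull ℝ (insert q (B '' (F : Set (Fin 4))))).sum_mem
      (t := Finset.univ) (w := w) (z := z) ?_ ?_ ?_
    · have heq : ∑ o, w o • z o = x := by
        rw [Fintype.sum_option]
        simp only [w, z, Option.elim]
        have : ∀ i, (B.coord i x - l * b i) • (if i ∈ F then B i else q) =
            B.coord i x • B i - l • (b i • B i) := by
          intro i
          by_cases hi : i ∈ F
          · rw [if_pos hi, sub_smul, mul_smul]
          · rw [hw0 i hi, zero_smul, smul_smul, ← sub_smul, hw0 i hi, zero_smul]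
        rw [Finset.sum_congr rfl (fun i _ => this i), Finset.sum_sub_distrib, ← Finset.smul_sum,
          B.linear_combination_coord_eq_self, B.linear_combination_coord_eq_self]
        abel
      rw [← heq]; exact hmem
    · rintro (_ | i) _
      · exact hl0.le
      · exact hwpos i
    · rw [Fintype.sum_option]
      simp only [w, Option.elim]
      rw [Finset.sum_sub_distrib, ← Finset.mul_sum, hsb, B.sum_coord_apply_eq_one]
      ring
    · rintro (_ | i) _
      · exact hqA
      · change (if i ∈ F then B i else q) ∈ _
        split_ifs with hi
        · exact subset_convexHull ℝ _ (mem_insert_of_mem _ ⟨i, hi, rfl⟩)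
        · exact hqA
  have hspan : ∀ x ∈ affineSpan ℝ A, ∀ i, i ∉ F → B.coord i x * b k = B.coord k x * b i := by
    intro x hx i hi
    rw [hA, affineSpan_convexHull] at hx
    have := affineMap_zero_of_mem_affineSpan (b k • B.coord i - b i • B.coord k) ?_ hx
    · have h5 : b k * B.coord i x - b i * B.coord k x = 0 := by simpa using this
      linear_combination h5
    · rintro y (rfl | hy)
      · simp [b]; ring
      · simp [hcoord0 i hi y hy, hcoord0 k hkF y hy]
  have hpA : p ∈ A := hcrit p (fun i hi => hnF i hi) (hp k) (fun i hi => (hF i).1 hi)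
  refine ⟨F, ?_, ?_, ?_, ?_, ?_⟩
  · intro i hi
    have h1 := hnF i hi
    have h2 : 0 < b i := hq i
    change a i < b i
    have : a i * b k < b i * b k := by rw [h1]; nlinarith
    exact lt_of_mul_lt_mul_right this hbk.le
  · intro h
    have := affineMap_zero_of_mem_affineSpan (B.coord k) (hcoord0 k hkF) h
    exact hbk.ne' this
  · rw [mem_intrinsicInterior]
    refine ⟨⟨p, subset_affineSpan ℝ A hpA⟩, ?_, rfl⟩
    rw [mem_interior]
    have hcont : ∀ i, Continuous fun x : affineSpan ℝ A => B.coord i (x : Fin 3 → ℝ) := fun i =>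
      (B.coord i).continuous_of_finiteDimensional.comp continuous_subtype_val
    refine ⟨{x | 0 < B.coord k (x : Fin 3 → ℝ)} ∩
      ⋂ i ∈ F, {x | B.coord k (x : Fin 3 → ℝ) * b i < B.coord i (x : Fin 3 → ℝ) * b k},
      ?_, ?_, ?_⟩
    · rintro x ⟨hx1, hx2⟩
      exact hcrit x (hspan x x.2) hx1 (fun i hi => by simpa using mem_iInter₂.1 hx2 i hi)
    · refine (isOpen_lt continuous_const (hcont k)).inter ?_
      refine isOpen_biInter_finset fun i _ => ?_
      exact isOpen_lt ((hcont k).mul continuous_const) ((hcont i).mul continuous_const)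
    · refine ⟨hp k, mem_iInter₂.2 fun i hi => (hF i).1 hi⟩
  · intro h
    obtain ⟨t, ht, hmem⟩ := exists_lineMap_mem_of_intrinsicInterior h hpA
    have h1 := hAk _ hmem
    rw [coord_lineMap] at h1
    change (1 - t) * a k + t * b k ≤ b k at h1
    nlinarith
  · intro x hx i
    obtain ⟨t, ht, hmem⟩ := exists_lineMap_mem_of_intrinsicInterior hx hqA
    have h1 := hAnonneg _ hmem i
    rw [coord_lineMap] at h1
    have h2 := hq i
    have h3 : 0 < t * B.coord i x := by nlinarith
    exact pos_of_mul_pos_right h3 (by linarith)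

lemma castPt_injective_s10 : Function.Injective (castPt (d := 3)) := by
  intro x y h
  funext i
  have := congrFun h i
  simpa [castPt] using this

/-- Adjoining a lattice point outside the affine span of a face. -/
lemma affineIndependent_insert_face (v : Fin 4 → Fin 3 → ℤ)
    (hv : AffineIndependent ℝ (fun i => castPt (v i))) (F : Finset (Fin 4)) (q : Fin 3 → ℤ)
    (hq : castPt q ∉ affineSpan ℝ ((fun i => castPt (v i)) '' (F : Set (Fin 4)))) :
    AffineIndependent ℝ
      (fun p : (insert q (F.image v) : Finset (Fin 3 → ℤ)) => castPt p.1) := by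
  classical
  let i₀ : (insert q (F.image v) : Finset (Fin 3 → ℤ)) := ⟨q, Finset.mem_insert_self _ _⟩
  have hmem : ∀ y : (insert q (F.image v) : Finset (Fin 3 → ℤ)), y ≠ i₀ → ∃ i ∈ F, v i = y.1 := by
    rintro ⟨y, hy⟩ hne
    rcases Finset.mem_insert.1 hy with rfl | hy
    · exact absurd rfl hne
    · exact Finset.mem_image.1 hy
  refine AffineIndependent.affineIndependent_of_notMem_span (i := i₀) ?_ ?_
  · let f : {y : (insert q (F.image v) : Finset (Fin 3 → ℤ)) // y ≠ i₀} → Fin 4 :=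
      fun y => (hmem y.1 y.2).choose
    have hf : ∀ y, v (f y) = y.1.1 := fun y => (hmem y.1 y.2).choose_spec.2
    have hinj : Function.Injective f := by
      intro y y' h
      apply Subtype.ext
      apply Subtype.ext
      rw [← hf, ← hf, h]
    have := hv.comp_embedding ⟨f, hinj⟩
    have hfun : (fun y : {y : (insert q (F.image v) : Finset (Fin 3 → ℤ)) // y ≠ i₀} =>
        castPt y.1.1) = (fun i => castPt (v i)) ∘ f := by
      funext y
      change castPt y.1.1 = castPt (v (f y))
      rw [hf]
    have h2 : AffineIndependent ℝ ((fun i => castPt (v i)) ∘ f) := this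
    rw [← hfun] at h2
    exact h2
  · intro h
    apply hq
    refine affineSpan_mono ℝ ?_ h
    rintro _ ⟨y, hy, rfl⟩
    obtain ⟨i, hi, h2⟩ := hmem y hy
    exact ⟨i, hi, by simp [h2]⟩

lemma finrank_insert_face (v : Fin 4 → Fin 3 → ℤ)
    (hv : AffineIndependent ℝ (fun i => castPt (v i))) (F : Finset (Fin 4)) (q : Fin 3 → ℤ)
    (hq : castPt q ∉ affineSpan ℝ ((fun i => castPt (v i)) '' (F : Set (Fin 4)))) :
    Module.finrank ℝ (affineSpan ℝ (castPt ''
      ((insert q (F.image v) : Finset (Fin 3 → ℤ)) : Set (Fin 3 → ℤ)))).direction = F.card := by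
  classical
  have hind := affineIndependent_insert_face v hv F q hq
  have hvinj : Function.Injective v := fun i j h => hv.injective (by simp [h])
  have hqn : q ∉ F.image v := by
    intro h
    obtain ⟨i, hi, rfl⟩ := Finset.mem_image.1 h
    exact hq (subset_affineSpan ℝ _ ⟨i, hi, rfl⟩)
  have hcard : Fintype.card (insert q (F.image v) : Finset (Fin 3 → ℤ)) = F.card + 1 := by
    rw [Fintype.card_coe, Finset.card_insert_of_notMem hqn, Finset.card_image_of_injective _ hvinj]
  have := hind.finrank_vectorSpan hcard
  have hset : castPt '' ((insert q (F.image v) : Finset (Fin 3 → ℤ)) : Set (Fin 3 → ℤ)) =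
      range (fun p : (insert q (F.image v) : Finset (Fin 3 → ℤ)) => castPt p.1) := by
    ext x
    simp
  rw [direction_affineSpan, hset]
  exact this

/-- Every lattice tetrahedron `S` with exactly two interior lattice points `o₁, o₂`
decomposes as `S = conv(S₁ ∪ S₂)` for two (possibly lower-dimensional) lattice simplices
`S₁ = conv V₁`, `S₂ = conv V₂` whose vertices are lattice points of `S`, such that
`o₂` is a vertex of `S₁` and `o₁` a vertex of `S₂`, the relative interior of `S₁` contains
exactly the lattice point `o₁` and that of `S₂` exactly `o₂`, and the number of common
vertices of `S₁` and `S₂` is `dim S₁ + dim S₂ − 4`. -/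
theorem two_point_tetrahedron_decomposition
    (v : Fin 4 → Fin 3 → ℤ) (hv : AffineIndependent ℝ (fun i => castPt (v i)))
    (S : Set (Fin 3 → ℝ)) (hS : S = convexHull ℝ (Set.range fun i => castPt (v i)))
    (o₁ o₂ : Fin 3 → ℤ) (ho : o₁ ≠ o₂)
    (hint : intLatPts S = {o₁, o₂}) :
    ∃ V₁ V₂ : Finset (Fin 3 → ℤ),
      (V₁ : Set (Fin 3 → ℤ)) ⊆ {x | castPt x ∈ S} ∧
      (V₂ : Set (Fin 3 → ℤ)) ⊆ {x | castPt x ∈ S} ∧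
      AffineIndependent ℝ (fun p : V₁ => castPt p.1) ∧
      AffineIndependent ℝ (fun p : V₂ => castPt p.1) ∧
      S = convexHull ℝ (castPt '' (V₁ : Set (Fin 3 → ℤ)) ∪ castPt '' (V₂ : Set (Fin 3 → ℤ))) ∧
      o₂ ∈ V₁ ∧ o₁ ∈ V₂ ∧
      {x : Fin 3 → ℤ |
        castPt x ∈ intrinsicInterior ℝ (convexHull ℝ (castPt '' (V₁ : Set (Fin 3 → ℤ))))}
        = {o₁} ∧
      {x : Fin 3 → ℤ |
        castPt x ∈ intrinsicInterior ℝ (convexHull ℝ (castPt '' (V₂ : Set (Fin 3 → ℤ))))}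
        = {o₂} ∧
      (V₁ ∩ V₂).card + 4 =
        Module.finrank ℝ (affineSpan ℝ (castPt '' (V₁ : Set (Fin 3 → ℤ)))).direction +
        Module.finrank ℝ (affineSpan ℝ (castPt '' (V₂ : Set (Fin 3 → ℤ)))).direction := by
  classical
  have htop : affineSpan ℝ (range fun i => castPt (v i)) = ⊤ := by
    rw [hv.affineSpan_eq_top_iff_card_eq_finrank_add_one]; simp
  let B : AffineBasis (Fin 4) ℝ (Fin 3 → ℝ) := ⟨fun i => castPt (v i), hv, htop⟩
  have hBv : ∀ i, B i = castPt (v i) := fun _ => rfl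
  have hBf : (B : Fin 4 → Fin 3 → ℝ) = fun i => castPt (v i) := rfl
  have hSB : S = convexHull ℝ (range B) := hS
  have hSint : ∀ x : Fin 3 → ℤ, (∀ i, 0 < B.coord i (castPt x)) ↔ x = o₁ ∨ x = o₂ := by
    intro x
    have h1 : x ∈ intLatPts S ↔ x = o₁ ∨ x = o₂ := by rw [hint]; simp
    rw [← h1, intLatPts, hSB, B.interior_convexHull]
    rfl
  have hc1 := (hSint o₁).2 (Or.inl rfl)
  have hc2 := (hSint o₂).2 (Or.inr rfl)
  have hne : castPt o₁ ≠ castPt o₂ := fun h => ho (castPt_injective_s10 h)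
  have hvinj : Function.Injective v := fun i j h => hv.injective (by simp [h])
  obtain ⟨F, hF1, hF2, hF3, hF4, hF5⟩ := half_decomposition B _ _ hc1 hc2 hne
  obtain ⟨G, hG1, hG2, hG3, hG4, hG5⟩ := half_decomposition B _ _ hc2 hc1 hne.symm
  rw [hBf] at hF2 hG2
  have hFG : F ∪ G = Finset.univ := by
    ext i
    simp only [Finset.mem_union, Finset.mem_univ, iff_true]
    by_contra h
    push Not at h
    exact absurd (hF1 i h.1) (hG1 i h.2).not_gt
  have himg : ∀ (q : Fin 3 → ℤ) (H : Finset (Fin 4)),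
      castPt '' ((insert q (H.image v) : Finset (Fin 3 → ℤ)) : Set (Fin 3 → ℤ)) =
        insert (castPt q) (B '' (H : Set (Fin 4))) := by
    intro q H
    rw [Finset.coe_insert, Finset.coe_image, image_insert_eq, image_image, hBf]
  have hvS : ∀ i, castPt (v i) ∈ S := fun i => by
    rw [hS]; exact subset_convexHull ℝ _ (mem_range_self i)
  have hoS : ∀ x : Fin 3 → ℤ, (∀ i, 0 < B.coord i (castPt x)) → castPt x ∈ S := by
    intro x hx
    rw [hSB, B.convexHull_eq_nonneg_coord]
    exact fun i => (hx i).le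
  have hVS : ∀ (q : Fin 3 → ℤ) (H : Finset (Fin 4)), castPt q ∈ S →
      ((insert q (H.image v) : Finset (Fin 3 → ℤ)) : Set (Fin 3 → ℤ)) ⊆ {x | castPt x ∈ S} := by
    intro q H hq x hx
    rcases Finset.mem_insert.1 (Finset.mem_coe.1 hx) with rfl | hx
    · exact hq
    · obtain ⟨i, _, rfl⟩ := Finset.mem_image.1 hx
      exact hvS i
  have hov : ∀ (x : Fin 3 → ℤ), (∀ i, 0 < B.coord i (castPt x)) → ∀ i, v i ≠ x := by
    rintro _ hx i rfl
    obtain ⟨j, hj⟩ := exists_ne i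
    have := hx j
    rw [← hBv, B.coord_apply_ne hj] at this
    exact lt_irrefl _ this
  have hVS1 := hVS o₂ F (hoS _ hc2)
  have hVS2 := hVS o₁ G (hoS _ hc1)
  refine ⟨insert o₂ (F.image v), insert o₁ (G.image v), hVS1, hVS2,
    affineIndependent_insert_face v hv F o₂ hF2, affineIndependent_insert_face v hv G o₁ hG2,
    ?_, Finset.mem_insert_self _ _, Finset.mem_insert_self _ _, ?_, ?_, ?_⟩
  · apply Subset.antisymm
    · rw [hS]
      refine convexHull_mono ?_
      rintro _ ⟨i, rfl⟩
      have : i ∈ F ∪ G := by rw [hFG]; exact Finset.mem_univ i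
      rcases Finset.mem_union.1 this with h | h
      · exact Or.inl ⟨v i, by simp [hvinj.eq_iff, h], rfl⟩
      · exact Or.inr ⟨v i, by simp [hvinj.eq_iff, h], rfl⟩
    · refine convexHull_min ?_ (by rw [hS]; exact convex_convexHull ℝ _)
      rintro _ (⟨x, hx, rfl⟩ | ⟨x, hx, rfl⟩)
      · exact hVS1 hx
      · exact hVS2 hx
  · rw [himg]
    ext x
    simp only [mem_ofPred_eq, mem_singleton_iff]
    constructor
    · intro hx
      rcases (hSint x).1 (hF5 _ hx) with h | rfl
      · exact h
      · exact absurd hx hF4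
    · rintro rfl
      exact hF3
  · rw [himg]
    ext x
    simp only [mem_ofPred_eq, mem_singleton_iff]
    constructor
    · intro hx
      rcases (hSint x).1 (hG5 _ hx) with rfl | h
      · exact absurd hx hG4
      · exact h
    · rintro rfl
      exact hG3
  · rw [finrank_insert_face v hv F o₂ hF2, finrank_insert_face v hv G o₁ hG2]
    have hinter : insert o₂ (F.image v) ∩ insert o₁ (G.image v) = (F ∩ G).image v := by
      rw [Finset.image_inter _ _ hvinj]
      ext x
      simp only [Finset.mem_inter, Finset.mem_insert, Finset.mem_image]
      constructor
      · rintro ⟨rfl | ⟨i, hi, rfl⟩, h | ⟨j, hj, h⟩⟩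
        · exact absurd h.symm ho
        · exact absurd h (hov _ hc2 j)
        · exact absurd h (hov _ hc1 i)
        · exact ⟨⟨i, hi, rfl⟩, ⟨j, hj, h⟩⟩
      · rintro ⟨h1, h2⟩
        exact ⟨Or.inr h1, Or.inr h2⟩
    rw [hinter, Finset.card_image_of_injective _ hvinj]
    have := Finset.card_union_add_card_inter F G
    rw [hFG, Finset.card_univ, Fintype.card_fin] at this
    omega
end
end
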